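/- Let p ∈ ℕ and let (r, k, m₁, m₃) belong to the set {(0,2,0,0), (1,2,0,0), (1,3,0,0), (2,3,1,1)} ∪ {(2j, k, 2j-1, 2j-1) : j, k ∈ ℕ} ∪ {(2j+1, k, 2j-1, 2j) : j ∈ ℕ₀, k ∈ ℕ}. Then there exists a constant c > 0 depending only on k, r, p, and for every A_p ∈ 𝔸_p there exists N ∈ ℕ depending only on d(A_p), such that for every f ∈ C^r with f ≥ 0 on I and every n ≥ N there exists a polynomial P_n of degree ≤ n satisfying: (1) P_n(x) ≥ 0 for all x ∈ I; (2) if m₁ ≥ 0 then P_n^(i)(α) = f^(i)(α) for all α ∈ A_p and 0 ≤ i ≤ m₁ (no condition if m₁ = -1); (3) P_n^(i)(±1) = f^(i)(±1) for 0 ≤ i ≤ m₃; and (4) |f(x) - P_n(x)| ≤ c ρ_n^r(x) ω_k(f^(r), ρ_n(x)) for all x ∈ I. -/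

import Mathlib

/-- The `k`-th modulus of smoothness of `g` with step bound `t` on `[a,b]`. -/
noncomputable def omegaK (g : ℝ → ℝ) (k : ℕ) (t a b : ℝ) : ℝ :=
  sSup {v : ℝ | ∃ h x : ℝ, 0 < h ∧ h ≤ t ∧ a ≤ x ∧ x + (k : ℝ) * h ≤ b ∧
    v = |∑ i ∈ Finset.range (k + 1),
      (-1 : ℝ) ^ (k - i) * (k.choose i : ℝ) * g (x + (i : ℝ) * h)|}

/-- `ρ_n(x) = n⁻¹ √(1 - x²) + n⁻²`. -/
noncomputable def rho (n : ℕ) (x : ℝ) : ℝ :=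
  Real.sqrt (1 - x ^ 2) / n + 1 / (n : ℝ) ^ 2

/-- The smallest positive distance between two distinct points of `S`. -/
noncomputable def minGap (S : Set ℝ) : ℝ :=
  sInf {d : ℝ | ∃ u ∈ S, ∃ v ∈ S, u ≠ v ∧ d = |u - v|}

namespace PositiveApprox
open Real Polynomial

/-- The rescaled angular distance on `[-1, 1]`. -/
noncomputable def angDist (n : ℕ) (x y : ℝ) : ℝ := 1 + n * |arccos x - arccos y|

lemma one_le_angDist (n : ℕ) (x y : ℝ) : 1 ≤ angDist n x y := by
  unfold angDist; have : 0 ≤ (n : ℝ) * |arccos x - arccos y| := by positivity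
  linarith

lemma angDist_pos (n : ℕ) (x y : ℝ) : 0 < angDist n x y :=
  lt_of_lt_of_le one_pos (one_le_angDist n x y)

lemma angDist_comm (n : ℕ) (x y : ℝ) : angDist n x y = angDist n y x := by
  unfold angDist; rw [abs_sub_comm]

lemma rho_pos {n : ℕ} (hn : 1 ≤ n) (x : ℝ) : 0 < rho n x := by
  unfold rho; have : (0 : ℝ) < n := by exact_mod_cast hn
  positivity

lemma rho_eq_sin (n : ℕ) (x : ℝ) : rho n x = sin (arccos x) / n + 1 / (n : ℝ) ^ 2 := by
  rw [sin_arccos]; rfl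

lemma rho_le {n : ℕ} (hn : 1 ≤ n) (x : ℝ) : rho n x ≤ 2 / n := by
  rw [rho_eq_sin]
  have h1 : (1 : ℝ) ≤ n := by exact_mod_cast hn
  have h0 : (0 : ℝ) < n := by linarith
  have h2 : sin (arccos x) / n ≤ 1 / n := by gcongr; exact sin_le_one _
  have h3 : 1 / (n : ℝ) ^ 2 ≤ 1 / n := by
    apply one_div_le_one_div_of_le h0; nlinarith
  have : (2 : ℝ) / n = 1 / n + 1 / n := by ring
  linarith

lemma sin_sub_sin_le (a b : ℝ) : sin a ≤ sin b + |a - b| := by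
  have := abs_sin_sub_sin_le a b
  have := le_abs_self (sin a - sin b)
  linarith

lemma rho_le_add {n : ℕ} (x y : ℝ) :
    rho n x ≤ rho n y + |arccos x - arccos y| / n := by
  rw [rho_eq_sin, rho_eq_sin]
  have h := sin_sub_sin_le (arccos x) (arccos y)
  have : sin (arccos x) / n ≤ (sin (arccos y) + |arccos x - arccos y|) / n := by gcongr
  rw [add_div] at this
  linarith

lemma inv_sq_le_rho (n : ℕ) (x : ℝ) : 1 / (n : ℝ) ^ 2 ≤ rho n x := by
  unfold rho; have : 0 ≤ √(1 - x ^ 2) / n := by positivity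
  linarith

lemma rho_le_angDist_mul {n : ℕ} (hn : 1 ≤ n) (x y : ℝ) :
    rho n x ≤ angDist n x y * rho n y := by
  have h0 : (0 : ℝ) < n := by exact_mod_cast hn
  have h := rho_le_add (n := n) x y
  have h2 : |arccos x - arccos y| / n ≤ n * |arccos x - arccos y| * rho n y := by
    have h3 := mul_le_mul_of_nonneg_left (inv_sq_le_rho n y)
      (show 0 ≤ n * |arccos x - arccos y| by positivity)
    have h4 : n * |arccos x - arccos y| * (1 / (n : ℝ) ^ 2) = |arccos x - arccos y| / n := by
      field_simp
    linarith
  unfold angDist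
  linarith

lemma cos_sub_cos_abs (a b : ℝ) :
    |cos a - cos b| = 2 * |sin ((a + b) / 2)| * |sin ((a - b) / 2)| := by
  rw [cos_sub_cos, abs_mul, abs_mul]; norm_num

section angles
variable {a b : ℝ} (ha : a ∈ Set.Icc 0 π) (hb : b ∈ Set.Icc 0 π)
include ha hb

lemma abs_sin_half_sub_ge : |a - b| / π ≤ |sin ((a - b) / 2)| := by
  have h1 : |a - b| ≤ π := by rw [abs_le]; constructor <;> linarith [ha.1, ha.2, hb.1, hb.2]
  have h2 : |sin ((a - b) / 2)| = sin (|a - b| / 2) := by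
    rw [abs_sin_eq_sin_abs_of_abs_le_pi]
    · rw [abs_div]; norm_num
    · rw [abs_div]; norm_num; linarith [pi_pos]
  rw [h2]
  have := mul_le_sin (x := |a - b| / 2) (by positivity) (by linarith)
  calc |a - b| / π = 2 / π * (|a - b| / 2) := by ring
    _ ≤ _ := this

lemma sin_half_add_nonneg : 0 ≤ sin ((a + b) / 2) :=
  sin_nonneg_of_nonneg_of_le_pi (by linarith [ha.1, hb.1]) (by linarith [ha.2, hb.2])

lemma abs_sin_half_sub_le : |sin ((a - b) / 2)| ≤ sin ((a + b) / 2) := by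
  have e1 : (a + b) / 2 = a / 2 + b / 2 := by ring
  have e2 : (a - b) / 2 = a / 2 - b / 2 := by ring
  rw [e1, e2, sin_add, sin_sub]
  have s1 : 0 ≤ sin (a / 2) := sin_nonneg_of_nonneg_of_le_pi (by linarith [ha.1]) (by linarith [ha.2, pi_pos])
  have s2 : 0 ≤ sin (b / 2) := sin_nonneg_of_nonneg_of_le_pi (by linarith [hb.1]) (by linarith [hb.2, pi_pos])
  have c1 : 0 ≤ cos (a / 2) := cos_nonneg_of_neg_pi_div_two_le_of_le (by linarith [ha.1, pi_pos]) (by linarith [ha.2])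
  have c2 : 0 ≤ cos (b / 2) := cos_nonneg_of_neg_pi_div_two_le_of_le (by linarith [hb.1, pi_pos]) (by linarith [hb.2])
  have := mul_nonneg s1 c2
  have := mul_nonneg c1 s2
  rw [abs_le]; constructor <;> linarith

lemma sin_le_two_mul_sin_half_add : sin b ≤ 2 * sin ((a + b) / 2) := by
  have e : b = (a + b) / 2 - (a - b) / 2 := by ring
  have h1 : sin b = sin ((a + b) / 2) * cos ((a - b) / 2) - cos ((a + b) / 2) * sin ((a - b) / 2) := by
    conv_lhs => rw [e]
    rw [sin_sub]
  have h2 := abs_sin_half_sub_le ha hb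
  have h3 := sin_half_add_nonneg ha hb
  have h4 : sin ((a + b) / 2) * cos ((a - b) / 2) ≤ sin ((a + b) / 2) * 1 :=
    mul_le_mul_of_nonneg_left (cos_le_one _) h3
  have h5 : |cos ((a + b) / 2) * sin ((a - b) / 2)| ≤ 1 * sin ((a + b) / 2) := by
    rw [abs_mul]; exact mul_le_mul (abs_cos_le_one _) h2 (abs_nonneg _) zero_le_one
  have h6 := neg_abs_le (cos ((a + b) / 2) * sin ((a - b) / 2))
  linarith

lemma abs_cos_sub_cos_ge :
    2 * (|a - b| / π) * (sin b / 4 + |a - b| / (2 * π)) ≤ |cos a - cos b| := by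
  rw [cos_sub_cos_abs, abs_of_nonneg (sin_half_add_nonneg ha hb)]
  have h1 := abs_sin_half_sub_ge ha hb
  have h2 := abs_sin_half_sub_le ha hb
  have h3 := sin_le_two_mul_sin_half_add ha hb
  have h4 : sin b / 4 + |a - b| / (2 * π) ≤ sin ((a + b) / 2) := by
    have : |a - b| / (2 * π) = |a - b| / π / 2 := by ring
    linarith
  have h5 : 0 ≤ |a - b| / π := by positivity
  have h6 := sin_half_add_nonneg ha hb
  calc _ ≤ 2 * (|a - b| / π) * sin ((a + b) / 2) := by gcongr
    _ ≤ 2 * |sin ((a - b) / 2)| * sin ((a + b) / 2) := by gcongr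
    _ = _ := by ring

lemma abs_cos_sub_cos_le : |cos a - cos b| ≤ |a - b| * (sin b + |a - b|) := by
  rw [cos_sub_cos_abs, abs_of_nonneg (sin_half_add_nonneg ha hb)]
  have h1 : |sin ((a - b) / 2)| ≤ |a - b| / 2 := by
    refine (abs_sin_le_abs).trans ?_
    rw [abs_div]; norm_num
  have h2 := sin_sub_sin_le ((a + b) / 2) b
  have h3 : |(a + b) / 2 - b| = |a - b| / 2 := by
    rw [show (a + b) / 2 - b = (a - b) / 2 by ring, abs_div]; norm_num
  have h4 := sin_half_add_nonneg ha hb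
  have h5 : 0 ≤ sin b := sin_nonneg_of_nonneg_of_le_pi hb.1 hb.2
  have h6 : sin ((a + b) / 2) ≤ sin b + |a - b| := by linarith [abs_nonneg (a - b)]
  calc _ ≤ 2 * (sin b + |a - b|) * (|a - b| / 2) := by gcongr
    _ = _ := by ring

end angles

lemma sin_arccos_nonneg (x : ℝ) : 0 ≤ sin (arccos x) :=
  sin_nonneg_of_nonneg_of_le_pi (arccos_nonneg x) (arccos_le_pi x)

lemma arccos_mem (x : ℝ) : arccos x ∈ Set.Icc 0 π := ⟨arccos_nonneg x, arccos_le_pi x⟩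

section points
variable {n : ℕ} (hn : 1 ≤ n) {x y : ℝ} (hx : x ∈ Set.Icc (-1 : ℝ) 1) (hy : y ∈ Set.Icc (-1 : ℝ) 1)
include hx hy

lemma abs_sub_ge_angle :
    2 * (|arccos x - arccos y| / π) * (sin (arccos y) / 4 + |arccos x - arccos y| / (2 * π))
      ≤ |x - y| := by
  have := abs_cos_sub_cos_ge (arccos_mem x) (arccos_mem y)
  rwa [cos_arccos hx.1 hx.2, cos_arccos hy.1 hy.2] at this

include hn

lemma abs_sub_le_rho_mul : |x - y| ≤ rho n y * angDist n x y ^ 2 := by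
  have h := abs_cos_sub_cos_le (arccos_mem x) (arccos_mem y)
  rw [cos_arccos hx.1 hx.2, cos_arccos hy.1 hy.2] at h
  refine h.trans ?_
  rw [rho_eq_sin]; unfold angDist
  have h0 : (0 : ℝ) < n := by exact_mod_cast hn
  have hs : 0 ≤ sin (arccos y) := sin_arccos_nonneg _
  set s := sin (arccos y)
  set u := |arccos x - arccos y|
  have hu : 0 ≤ u := abs_nonneg _
  have e1 : u * (s + u) = (s / n) * (n * u) + 1 / (n : ℝ) ^ 2 * (n * u) ^ 2 := by
    field_simp
  rw [e1, add_mul]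
  have : 0 ≤ n * u := by positivity
  gcongr
  · nlinarith
  · linarith

lemma angDist_le_of_abs_sub_le (h : |x - y| ≤ rho n y) : angDist n x y ≤ 11 := by
  have h0 : (0 : ℝ) < n := by exact_mod_cast hn
  have hl := abs_sub_ge_angle hx hy
  have hs : 0 ≤ sin (arccos y) := sin_arccos_nonneg _
  rw [rho_eq_sin] at h
  unfold angDist
  set s := sin (arccos y)
  set u := |arccos x - arccos y|
  have hu : 0 ≤ u := abs_nonneg _
  by_contra! hc
  have hD : 10 < n * u := by linarith
  have hu' : 10 / n < u := by rw [div_lt_iff₀ h0]; linarith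
  have hpi : π < 3.15 := pi_lt_d2
  have hpi0 := pi_pos
  have h1 : 2 * (10 / n / π) * (s / 4 + 10 / n / (2 * π)) ≤ s / n + 1 / (n : ℝ) ^ 2 := by
    refine le_trans ?_ (hl.trans h)
    gcongr
  have e1 : 2 * (10 / n / π) * (s / 4 + 10 / n / (2 * π))
      = (5 / π) * (s / n) + (100 / π ^ 2) * (1 / (n : ℝ) ^ 2) := by
    field_simp; ring
  rw [e1] at h1
  have h5 : 1 < 5 / π := by rw [lt_div_iff₀ hpi0]; linarith
  have h6 : 1 < 100 / π ^ 2 := by rw [lt_div_iff₀ (by positivity)]; nlinarith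
  have h7 : 0 ≤ s / n := by positivity
  have h8 : 0 < 1 / (n : ℝ) ^ 2 := by positivity
  nlinarith

lemma rho_le_abs_sub_add : rho n x ≤ 4 * (|x - y| + rho n y) := by
  have h0 : (0 : ℝ) < n := by exact_mod_cast hn
  have hl := abs_sub_ge_angle hx hy
  have hs : 0 ≤ sin (arccos y) := sin_arccos_nonneg _
  have h1 := rho_le_add (n := n) x y
  have h2 := inv_sq_le_rho n y
  set s := sin (arccos y)
  set u := |arccos x - arccos y|
  have hu : 0 ≤ u := abs_nonneg _
  have hpi : π < 3.15 := pi_lt_d2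
  have hpi0 := pi_pos
  have h3 : u ^ 2 / 10 ≤ |x - y| := by
    refine le_trans ?_ hl
    have e : 2 * (u / π) * (s / 4 + u / (2 * π)) = u / π * s / 2 + u ^ 2 / π ^ 2 := by
      field_simp; ring
    rw [e]
    have : u ^ 2 / 10 ≤ u ^ 2 / π ^ 2 := by gcongr; nlinarith
    have : 0 ≤ u / π * s / 2 := by positivity
    linarith
  have h4 : u / n ≤ u ^ 2 / 10 + 2.5 * (1 / (n : ℝ) ^ 2) := by
    have : (1 / (n : ℝ)) ^ 2 = 1 / (n : ℝ) ^ 2 := by ring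
    have e : u / n = u * (1 / n) := by ring
    rw [← this, e]
    nlinarith [sq_nonneg (u - 5 * (1 / n))]
  have := abs_nonneg (x - y)
  linarith [rho_pos hn y]

end points

lemma abs_sin_int_mul_le (z : ℤ) (u : ℝ) : |sin (z * u)| ≤ |(z : ℝ)| * |sin u| := by
  have key : ∀ m : ℕ, |sin (m * u)| ≤ m * |sin u| := by
    intro m
    induction m with
    | zero => simp
    | succ m ih =>
      push_cast
      rw [add_mul, one_mul, sin_add]
      calc _ ≤ |sin (m * u) * cos u| + |cos (m * u) * sin u| := abs_add_le _ _
        _ ≤ |sin (m * u)| * 1 + 1 * |sin u| := by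
          rw [abs_mul, abs_mul]; gcongr <;> exact abs_cos_le_one _
        _ ≤ _ := by linarith
  rcases Int.eq_nat_or_neg z with ⟨m, rfl | rfl⟩
  · simpa using key m
  · simpa [neg_mul, sin_neg, abs_neg] using key m

lemma abs_cos_int_mul_sub_le {n : ℕ} (hn : 1 ≤ n) {x y : ℝ} (hx : x ∈ Set.Icc (-1 : ℝ) 1)
    (hy : y ∈ Set.Icc (-1 : ℝ) 1) (z : ℤ) (hz : |(z : ℝ)| ≤ n) :
    |cos (z * arccos x) - cos (z * arccos y)| ≤ 4 * (|x - y| / rho n y) := by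
  have h0 : (0 : ℝ) < n := by exact_mod_cast hn
  set a := arccos x
  set b := arccos y
  have ha : a ∈ Set.Icc 0 π := arccos_mem x
  have hb : b ∈ Set.Icc 0 π := arccos_mem y
  have hxy : |x - y| = 2 * sin ((a + b) / 2) * |sin ((a - b) / 2)| := by
    rw [← abs_of_nonneg (sin_half_add_nonneg ha hb), ← cos_sub_cos_abs, cos_arccos hx.1 hx.2,
      cos_arccos hy.1 hy.2]
  have e1 : |cos (z * a) - cos (z * b)| = 2 * |sin (z * ((a + b) / 2))| * |sin (z * ((a - b) / 2))| := by
    rw [cos_sub_cos_abs]; congr 3 <;> ring_nf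
  have hS := sin_half_add_nonneg ha hb
  have h2 : |sin (z * ((a - b) / 2))| ≤ n * |sin ((a - b) / 2)| :=
    (abs_sin_int_mul_le z _).trans (by gcongr)
  have h1 : |sin (z * ((a + b) / 2))| ≤ n * sin ((a + b) / 2) := by
    refine (abs_sin_int_mul_le z _).trans ?_
    rw [abs_of_nonneg hS]; gcongr
  have hρ := rho_pos hn y
  rw [e1, ← mul_div_assoc 4, le_div_iff₀ hρ]
  have hsb := sin_le_two_mul_sin_half_add ha hb
  have hρe : rho n y = sin b / n + 1 / (n : ℝ) ^ 2 := rho_eq_sin n y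
  have hsb0 : 0 ≤ sin b := sin_arccos_nonneg _
  set A := |sin (z * ((a + b) / 2))|
  set B := |sin (z * ((a - b) / 2))|
  set s := |sin ((a - b) / 2)|
  set t := sin ((a + b) / 2)
  have hs : 0 ≤ s := abs_nonneg _
  have hA1 : A ≤ 1 := abs_sin_le_one _
  have hA0 : 0 ≤ A := abs_nonneg _
  have hB0 : 0 ≤ B := abs_nonneg _
  rw [hxy, hρe, mul_add]
  have p1 : 2 * A * B * (sin b / n) ≤ 4 * t * s := by
    calc 2 * A * B * (sin b / n) ≤ 2 * 1 * (n * s) * (2 * t / n) := by gcongr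
      _ = 4 * t * s := by field_simp; ring
  have p2 : 2 * A * B * (1 / (n : ℝ) ^ 2) ≤ 2 * t * s := by
    calc 2 * A * B * (1 / (n : ℝ) ^ 2) ≤ 2 * (n * t) * (n * s) * (1 / (n : ℝ) ^ 2) := by gcongr
      _ = 2 * t * s := by field_simp
  nlinarith [mul_nonneg hS hs]

/-- The Fejér kernel normalised to be `1` at the origin. -/
noncomputable def fejer (n : ℕ) (θ : ℝ) : ℝ :=
  ((∑ l ∈ Finset.range n, cos (l * θ)) ^ 2 + (∑ l ∈ Finset.range n, sin (l * θ)) ^ 2) / (n : ℝ) ^ 2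

/-- The Fejér kernel as a polynomial in `cos θ`. -/
noncomputable def fejerPoly (n : ℕ) : ℝ[X] :=
  C (1 / (n : ℝ) ^ 2) * ∑ l ∈ Finset.range n, ∑ l' ∈ Finset.range n,
    Chebyshev.T ℝ ((l : ℤ) - (l' : ℤ))

lemma fejer_nonneg (n : ℕ) (θ : ℝ) : 0 ≤ fejer n θ := by unfold fejer; positivity

lemma two_sin_half_mul_sum_cos (n : ℕ) (θ : ℝ) :
    2 * sin (θ / 2) * ∑ l ∈ Finset.range n, cos (l * θ) = sin ((n - 1 / 2) * θ) + sin (θ / 2) := by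
  induction n with
  | zero => simp; rw [show (2⁻¹ : ℝ) * θ = θ / 2 by ring]; ring
  | succ n ih =>
    rw [Finset.sum_range_succ, mul_add, ih]; push_cast
    rw [show ((n : ℝ) + 1 - 1 / 2) * θ = n * θ + θ / 2 by ring,
      show ((n : ℝ) - 1 / 2) * θ = n * θ - θ / 2 by ring, sin_add, sin_sub]; ring

lemma two_sin_half_mul_sum_sin (n : ℕ) (θ : ℝ) :
    2 * sin (θ / 2) * ∑ l ∈ Finset.range n, sin (l * θ) = cos (θ / 2) - cos ((n - 1 / 2) * θ) := by
  induction n with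
  | zero => simp; rw [show (2⁻¹ : ℝ) * θ = θ / 2 by ring]; ring
  | succ n ih =>
    rw [Finset.sum_range_succ, mul_add, ih]; push_cast
    rw [show ((n : ℝ) + 1 - 1 / 2) * θ = n * θ + θ / 2 by ring,
      show ((n : ℝ) - 1 / 2) * θ = n * θ - θ / 2 by ring, cos_add, cos_sub]; ring

lemma fejer_mul_sin_sq {n : ℕ} (hn : 1 ≤ n) (θ : ℝ) :
    fejer n θ * ((n : ℝ) ^ 2 * sin (θ / 2) ^ 2) = sin (n * θ / 2) ^ 2 := by
  have h0 : (n : ℝ) ≠ 0 := by positivity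
  have h1 := two_sin_half_mul_sum_cos n θ
  have h2 := two_sin_half_mul_sum_sin n θ
  have e : fejer n θ * ((n : ℝ) ^ 2 * sin (θ / 2) ^ 2) =
      ((2 * sin (θ / 2) * ∑ l ∈ Finset.range n, cos (l * θ)) ^ 2 +
      (2 * sin (θ / 2) * ∑ l ∈ Finset.range n, sin (l * θ)) ^ 2) / 4 := by
    unfold fejer
    generalize ∑ l ∈ Finset.range n, cos (l * θ) = A
    generalize ∑ l ∈ Finset.range n, sin (l * θ) = B
    field_simp; ring
  rw [e, h1, h2, show ((n : ℝ) - 1 / 2) * θ = n * θ / 2 + (n * θ / 2 - θ / 2) by ring]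
  set A := (n : ℝ) * θ / 2
  have s1 := sin_sq_add_cos_sq A
  have s2 := sin_sq_add_cos_sq (θ / 2)
  rw [sin_add, cos_add, sin_sub, cos_sub]
  set a := sin A
  set b := cos A
  set c := sin (θ / 2)
  set d := cos (θ / 2)
  have hb : b ^ 2 = 1 - a ^ 2 := by linarith
  have hd : d ^ 2 = 1 - c ^ 2 := by linarith
  ring_nf
  have hb4 : b ^ 4 = (1 - a ^ 2) ^ 2 := by rw [← hb]; ring
  simp only [hb, hd, hb4]
  ring

lemma fejer_eq_sum (n : ℕ) (θ : ℝ) :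
    fejer n θ = 1 / (n : ℝ) ^ 2 * ∑ l ∈ Finset.range n, ∑ l' ∈ Finset.range n,
      cos ((((l : ℤ) - (l' : ℤ) : ℤ) : ℝ) * θ) := by
  unfold fejer
  rw [sq, sq, Finset.sum_mul_sum, Finset.sum_mul_sum, ← Finset.sum_add_distrib, div_eq_mul_one_div,
    mul_comm]
  congr 1
  refine Finset.sum_congr rfl fun l _ => ?_
  rw [← Finset.sum_add_distrib]
  refine Finset.sum_congr rfl fun l' _ => ?_
  push_cast
  rw [sub_mul, cos_sub]

lemma fejer_le_one {n : ℕ} (hn : 1 ≤ n) (θ : ℝ) : fejer n θ ≤ 1 := by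
  have h0 : (0 : ℝ) < n := by exact_mod_cast hn
  rw [fejer_eq_sum, one_div, inv_mul_le_iff₀ (by positivity)]
  calc _ ≤ ∑ l ∈ Finset.range n, ∑ l' ∈ Finset.range n, (1 : ℝ) :=
        Finset.sum_le_sum fun l _ => Finset.sum_le_sum fun l' _ => cos_le_one _
    _ = _ := by simp; ring

lemma fejer_zero {n : ℕ} (hn : 1 ≤ n) : fejer n 0 = 1 := by
  have h0 : (n : ℝ) ≠ 0 := by positivity
  unfold fejer; simp [h0]

lemma fejerPoly_eval_cos (n : ℕ) (θ : ℝ) : (fejerPoly n).eval (cos θ) = fejer n θ := by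
  rw [fejer_eq_sum, fejerPoly, eval_mul, eval_C, eval_finsetSum]
  congr 1
  refine Finset.sum_congr rfl fun l _ => ?_
  rw [eval_finsetSum]
  refine Finset.sum_congr rfl fun l' _ => ?_
  rw [Chebyshev.T_real_cos]

lemma fejerPoly_natDegree_le (n : ℕ) : (fejerPoly n).natDegree ≤ n := by
  unfold fejerPoly
  refine (natDegree_C_mul_le _ _).trans ?_
  refine natDegree_sum_le_of_forall_le _ _ fun l hl => ?_
  refine natDegree_sum_le_of_forall_le _ _ fun l' hl' => ?_
  rw [Chebyshev.natDegree_T]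
  have := Finset.mem_range.1 hl
  have := Finset.mem_range.1 hl'
  omega

lemma fejer_le_of_sin {n : ℕ} (hn : 1 ≤ n) {φ u : ℝ} (hu : 0 ≤ u) (h : u / π ≤ |sin (φ / 2)|) :
    fejer n φ * (1 + n * u) ^ 2 ≤ 22 := by
  have h1 := fejer_mul_sin_sq hn φ
  have h2 := fejer_le_one hn φ
  have h3 := fejer_nonneg n φ
  have hpi : π < 3.15 := pi_lt_d2
  have hpi0 := pi_pos
  have h4 : (u / π) ^ 2 ≤ sin (φ / 2) ^ 2 := by
    rw [← sq_abs (sin _)]; exact pow_le_pow_left₀ (by positivity) h 2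
  have h5 : fejer n φ * ((n : ℝ) ^ 2 * (u / π) ^ 2) ≤ 1 := by
    calc _ ≤ fejer n φ * ((n : ℝ) ^ 2 * sin (φ / 2) ^ 2) := by gcongr
      _ ≤ 1 := by rw [h1]; exact sin_sq_le_one _
  have h6 : fejer n φ * (n * u) ^ 2 ≤ π ^ 2 := by
    have e : fejer n φ * ((n : ℝ) ^ 2 * (u / π) ^ 2) = fejer n φ * (n * u) ^ 2 / π ^ 2 := by
      field_simp
    rw [e, div_le_one (by positivity)] at h5
    exact h5
  have h7 : fejer n φ * (1 + n * u) ^ 2 ≤ fejer n φ * (2 + 2 * (n * u) ^ 2) := by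
    gcongr; nlinarith [sq_nonneg (1 - n * u)]
  nlinarith

section
variable {n : ℕ} (hn : 1 ≤ n) {a b : ℝ} (ha : a ∈ Set.Icc 0 π) (hb : b ∈ Set.Icc 0 π)
include hn ha hb

lemma fejer_sub_le : fejer n (a - b) * (1 + n * |a - b|) ^ 2 ≤ 22 :=
  fejer_le_of_sin hn (abs_nonneg _) (abs_sin_half_sub_ge ha hb)

lemma fejer_add_le : fejer n (a + b) * (1 + n * |a - b|) ^ 2 ≤ 22 := by
  refine fejer_le_of_sin hn (abs_nonneg _) ((abs_sin_half_sub_ge ha hb).trans ?_)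
  exact (abs_sin_half_sub_le ha hb).trans (le_abs_self _)

omit ha hb in
lemma fejer_sub_ge (h : n * |a - b| ≤ π) : 1 / 4 ≤ fejer n (a - b) := by
  have h0 : (0 : ℝ) < n := by exact_mod_cast hn
  have hpi : π < 3.15 := pi_lt_d2
  have hpi0 := pi_pos
  rcases eq_or_ne (a - b) 0 with h' | h'
  · rw [h', fejer_zero hn]; norm_num
  have h1 := fejer_mul_sin_sq hn (a - b)
  set u := a - b
  have h2 : sin (u / 2) ^ 2 ≤ (u / 2) ^ 2 := sq_le_sq.2 abs_sin_le_abs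
  have h3 : 2 / π * (n * |u| / 2) ≤ |sin (n * u / 2)| := by
    have e : |sin (n * u / 2)| = sin (n * |u| / 2) := by
      have : |n * u / 2| = n * |u| / 2 := by
        rw [abs_div, abs_mul]; simp
      rw [abs_sin_eq_sin_abs_of_abs_le_pi (by rw [this]; linarith), this]
    rw [e]
    exact mul_le_sin (by positivity) (by linarith)
  have h4 : (2 / π * (n * |u| / 2)) ^ 2 ≤ sin (n * u / 2) ^ 2 := by
    rw [← sq_abs (sin _)]; exact pow_le_pow_left₀ (by positivity) h3 2
  rw [← h1] at h4
  have h5 : fejer n u * ((n : ℝ) ^ 2 * sin (u / 2) ^ 2) ≤ fejer n u * ((n : ℝ) ^ 2 * (u / 2) ^ 2) := by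
    have := fejer_nonneg n u
    gcongr
  have hu2 : 0 < u ^ 2 := by positivity
  have h6 : (2 / π * (n * |u| / 2)) ^ 2 = 4 / π ^ 2 * ((n : ℝ) ^ 2 * (u / 2) ^ 2) := by
    have e : |u| ^ 2 = u ^ 2 := sq_abs u
    rw [mul_pow, div_pow (n * |u|), mul_pow (n : ℝ), e]; ring
  rw [h6] at h4
  have h7 := le_of_mul_le_mul_right (h4.trans h5) (by positivity)
  refine le_trans ?_ h7
  rw [le_div_iff₀ (by positivity)]; nlinarith

end

lemma exists_chebyshev_expansion (N : ℕ) : ∀ p : ℝ[X], p.natDegree ≤ N →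
    ∃ c : ℕ → ℝ, p = ∑ l ∈ Finset.range (N + 1), C (c l) * Chebyshev.T ℝ (l : ℤ) := by
  induction N with
  | zero =>
    intro p hp
    refine ⟨fun _ => p.coeff 0, ?_⟩
    simpa using eq_C_of_natDegree_le_zero hp
  | succ N ih =>
    intro p hp
    set t : ℝ[X] := Chebyshev.T ℝ ((N + 1 : ℕ) : ℤ) with ht
    have hd : t.natDegree = N + 1 := by rw [ht, Chebyshev.natDegree_T, Int.natAbs_natCast]
    have hl : t.coeff (N + 1) ≠ 0 := by
      have : t.leadingCoeff ≠ 0 := leadingCoeff_ne_zero.2 (Chebyshev.T_ne_zero ℝ _)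
      rwa [leadingCoeff, hd] at this
    set e := p.coeff (N + 1) / t.coeff (N + 1)
    obtain ⟨c, hc⟩ := ih (p - C e * t) (by
      rw [natDegree_le_iff_coeff_eq_zero]
      intro i hi
      rw [coeff_sub, coeff_C_mul]
      rcases eq_or_lt_of_le (Nat.succ_le_of_lt hi) with h | h
      · rw [← h]; simp only [e, Nat.succ_eq_add_one]; field_simp; ring
      · rw [coeff_eq_zero_of_natDegree_lt (by omega), coeff_eq_zero_of_natDegree_lt (by omega)]
        ring)
    refine ⟨fun l => if l = N + 1 then e else c l, ?_⟩
    rw [Finset.sum_range_succ, ← ht]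
    simp only [if_true]
    rw [Finset.sum_congr rfl (g := fun l => C (c l) * Chebyshev.T ℝ (l : ℤ)), ← hc]
    · ring
    · intro l hl
      have := Finset.mem_range.1 hl
      rw [if_neg (by omega)]

lemma sum_cos_odd_mul (N : ℕ) (β : ℝ) :
    (∑ j ∈ Finset.range N, cos ((2 * j + 1) * β)) * (2 * sin β) = sin (2 * N * β) := by
  induction N with
  | zero => simp
  | succ N ih =>
    rw [Finset.sum_range_succ, add_mul, ih]; push_cast
    rw [show 2 * ((N : ℝ) + 1) * β = (2 * N + 1) * β + β by ring,
      show 2 * (N : ℝ) * β = (2 * N + 1) * β - β by ring, sin_add, sin_sub]; ring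

lemma sum_cos_nodes_eq_zero {N l : ℕ} (hl0 : 0 < l) (hl : l < 2 * N) :
    ∑ j ∈ Finset.range N, cos (l * ((2 * j + 1) * (π / (2 * N)))) = 0 := by
  have hN : (0 : ℝ) < N := by
    have : 0 < N := by omega
    exact_mod_cast this
  have h := sum_cos_odd_mul N (l * (π / (2 * N)))
  have hs : sin (2 * N * (l * (π / (2 * N)))) = 0 := by
    rw [show 2 * (N : ℝ) * (l * (π / (2 * N))) = l * π by field_simp]
    exact sin_nat_mul_pi l
  rw [hs] at h
  have hpos : 0 < sin (l * (π / (2 * N))) := by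
    apply sin_pos_of_pos_of_lt_pi
    · have : (0 : ℝ) < l := by exact_mod_cast hl0
      positivity
    · have : (l : ℝ) < 2 * N := by exact_mod_cast hl
      rw [mul_div_assoc', div_lt_iff₀ (by positivity)]
      nlinarith [pi_pos]
  have h2 := (mul_eq_zero.1 h).resolve_right (by positivity)
  rw [← h2]
  refine Finset.sum_congr rfl fun j _ => ?_
  congr 1; ring

lemma exists_symmetrized {N N' : ℕ} (p : ℝ[X]) (hp : p.natDegree ≤ N) (hN : N < 2 * N') :
    ∃ (Φ : ℕ → ℝ[X]) (Z : ℝ), (∀ j, (Φ j).natDegree ≤ N) ∧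
      (∀ j θ, (Φ j).eval (cos θ) = p.eval (cos (θ - (2 * j + 1) * (π / (2 * N'))))
        + p.eval (cos (θ + (2 * j + 1) * (π / (2 * N'))))) ∧
      ∑ j ∈ Finset.range N', Φ j = C Z := by
  obtain ⟨c, hc⟩ := exists_chebyshev_expansion N p hp
  refine ⟨fun j => ∑ l ∈ Finset.range (N + 1),
    C (2 * c l * cos (l * ((2 * j + 1) * (π / (2 * N'))))) * Chebyshev.T ℝ (l : ℤ),
    2 * N' * c 0, ?_, ?_, ?_⟩
  · intro j
    refine natDegree_sum_le_of_forall_le _ _ fun l hl => ?_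
    refine (natDegree_C_mul_le _ _).trans ?_
    rw [Chebyshev.natDegree_T]
    have := Finset.mem_range.1 hl
    simp; omega
  · intro j θ
    rw [hc]
    simp only [eval_finsetSum, eval_mul, eval_C, Chebyshev.T_real_cos]
    rw [← Finset.sum_add_distrib]
    refine Finset.sum_congr rfl fun l _ => ?_
    push_cast
    rw [mul_sub, mul_add (l : ℝ) θ, cos_sub, cos_add]; ring
  · rw [Finset.sum_comm, Finset.sum_range_succ', Finset.sum_eq_zero]
    · simp only [Nat.cast_zero, zero_mul, cos_zero, mul_one, Chebyshev.T_zero, zero_add, Finset.sum_const,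
        Finset.card_range, nsmul_eq_mul]
      simp [C_mul]; ring
    · intro l hl
      have hl' := Finset.mem_range.1 hl
      rw [← Finset.sum_mul, ← map_sum, ← Finset.mul_sum, sum_cos_nodes_eq_zero (by omega) (by omega)]
      simp

lemma sum_inv_one_add_abs_sq_le (u : ℝ) (N : ℕ) :
    ∑ j ∈ Finset.range N, (1 / (1 + |u - j|) ^ 2) ≤ 4 := by
  set S : ℝ → ℝ := fun v => v / (1 + |v|) with hS
  have key : ∀ v : ℝ, 1 / (1 + |v|) ^ 2 ≤ 2 * (S (v + 1) - S v) := by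
    intro v
    simp only [hS]
    rcases le_or_gt 0 v with h | h
    · rw [abs_of_nonneg h, abs_of_nonneg (by linarith : 0 ≤ v + 1), div_sub_div _ _ (by linarith) (by linarith),
        mul_div_assoc', div_le_div_iff₀ (by positivity) (by positivity)]
      nlinarith [mul_nonneg h h, mul_nonneg (mul_nonneg h h) h]
    · rw [abs_of_neg h]
      rcases le_or_gt (v + 1) 0 with h1 | h1
      · rw [abs_of_nonpos h1, div_sub_div _ _ (by linarith) (by linarith),
          mul_div_assoc', div_le_div_iff₀ (by nlinarith) (by nlinarith)]
        obtain ⟨w, rfl⟩ : ∃ w, v = -1 - w := ⟨-1 - v, by ring⟩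
        have hw : 0 ≤ w := by linarith
        nlinarith [mul_nonneg hw hw, mul_nonneg (mul_nonneg hw hw) hw]
      · rw [abs_of_pos h1, div_sub_div _ _ (by linarith) (by linarith),
          mul_div_assoc', div_le_div_iff₀ (by nlinarith) (by nlinarith)]
        obtain ⟨w, rfl⟩ : ∃ w, v = - w := ⟨-v, by ring⟩
        have hw : 0 < w := by linarith
        have hw1 : 0 < 1 - w := by linarith
        nlinarith [mul_pos hw hw1, mul_pos (mul_pos hw hw1) hw, mul_pos (mul_pos hw hw1) hw1]
  have habs : ∀ v, |S v| ≤ 1 := by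
    intro v; simp only [hS]; rw [abs_div, abs_of_pos (by positivity : 0 < 1 + |v|), div_le_one (by positivity)]
    linarith
  have tel : ∑ j ∈ Finset.range N, (S ((j : ℝ) - u + 1) - S (j - u)) = S (N - u) - S (0 - u) := by
    induction N with
    | zero => simp
    | succ N ih => rw [Finset.sum_range_succ, ih]; push_cast; rw [show (N : ℝ) + 1 - u = N - u + 1 by ring]; ring
  calc _ ≤ ∑ j ∈ Finset.range N, 2 * (S ((j : ℝ) - u + 1) - S (j - u)) := by
        refine Finset.sum_le_sum fun j _ => ?_
        rw [abs_sub_comm]; exact key _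
    _ = 2 * (S (N - u) - S (0 - u)) := by rw [← Finset.mul_sum, tel]
    _ ≤ 4 := by
      have := abs_le.1 (habs (N - u))
      have := abs_le.1 (habs (0 - u))
      linarith

lemma exists_near_node {N : ℕ} (hN : 1 ≤ N) {u : ℝ} (h0 : -(1 / 2) ≤ u) (h1 : u ≤ N - 1 / 2) :
    ∃ j < N, |u - j| ≤ 1 / 2 := by
  rcases lt_or_ge u (N - 1) with h | h
  · have hf := Nat.floor_le (show 0 ≤ u + 1 / 2 by linarith)
    have hf' := Nat.lt_floor_add_one (u + 1 / 2)
    refine ⟨⌊u + 1 / 2⌋₊, ?_, ?_⟩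
    · have : (⌊u + 1 / 2⌋₊ : ℝ) < N := by linarith
      exact_mod_cast this
    · rw [abs_le]; constructor <;> linarith
  · refine ⟨N - 1, by omega, ?_⟩
    rw [Nat.cast_sub hN, abs_le]; push_cast; constructor <;> linarith

theorem exists_kernel (m : ℕ) (hm : 1 ≤ m) : ∃ C c : ℝ, 0 < C ∧ 0 < c ∧ ∀ n : ℕ, 1 ≤ n →
    ∃ (N : ℕ) (ξ : ℕ → ℝ) (Φ : ℕ → ℝ[X]),
      (∀ j ∈ Finset.range N, ξ j ∈ Set.Icc (-1 : ℝ) 1) ∧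
      (∀ j ∈ Finset.range N, (Φ j).natDegree ≤ m * n) ∧
      (∀ j ∈ Finset.range N, ∀ x ∈ Set.Icc (-1 : ℝ) 1, 0 ≤ (Φ j).eval x) ∧
      (∑ j ∈ Finset.range N, Φ j = 1) ∧
      (∀ j ∈ Finset.range N, ∀ x ∈ Set.Icc (-1 : ℝ) 1,
        (Φ j).eval x * angDist n x (ξ j) ^ (2 * m) ≤ C) ∧
      (∀ x ∈ Set.Icc (-1 : ℝ) 1, ∑ j ∈ Finset.range N, 1 / angDist n x (ξ j) ^ 2 ≤ C) ∧
      (∀ x ∈ Set.Icc (-1 : ℝ) 1, ∃ j ∈ Finset.range N,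
        c ≤ (Φ j).eval x ∧ angDist n x (ξ j) ≤ 5) := by
  have hmR : (1 : ℝ) ≤ m := by exact_mod_cast hm
  have hpi := pi_gt_three
  have hpi' : π < 3.15 := pi_lt_d2
  set K : ℝ := 2 * 22 ^ m with hK
  have hK0 : 0 < K := by positivity
  refine ⟨K / (1 / 4) ^ m + 4 * m ^ 2, (1 / 4) ^ m / (K * (4 * m ^ 2)), by positivity, by positivity,
    fun n hn => ?_⟩
  have hn0 : (0 : ℝ) < n := by exact_mod_cast hn
  obtain ⟨φ, Z, hdeg, hev, hsum⟩ := exists_symmetrized (N := m * n) (N' := m * n) (fejerPoly n ^ m)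
    (natDegree_pow_le_of_le m (fejerPoly_natDegree_le n)) (by
      have : 0 < m * n := Nat.mul_pos hm hn
      omega)
  set η : ℕ → ℝ := fun j => (2 * j + 1) * (π / (2 * (m * n : ℕ))) with hη
  have hηn : ∀ j, η j = (π / m) * (j + 1 / 2) / n := by
    intro j; simp only [hη]; push_cast; field_simp
  have hη_mem : ∀ j ∈ Finset.range (m * n), η j ∈ Set.Icc 0 π := by
    intro j hj
    have hj' : (j : ℝ) + 1 ≤ m * n := by exact_mod_cast Finset.mem_range.1 hj
    rw [hηn]
    refine ⟨by positivity, ?_⟩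
    rw [div_le_iff₀ hn0, div_mul_eq_mul_div, div_le_iff₀ (by positivity)]
    nlinarith [pi_pos]
  set ξ : ℕ → ℝ := fun j => cos (η j) with hξ
  have harc : ∀ j ∈ Finset.range (m * n), arccos (ξ j) = η j := fun j hj =>
    arccos_cos (hη_mem j hj).1 (hη_mem j hj).2
  have hval : ∀ j, ∀ x ∈ Set.Icc (-1 : ℝ) 1, (φ j).eval x =
      fejer n (arccos x - η j) ^ m + fejer n (arccos x + η j) ^ m := by
    intro j x hx
    have h := hev j (arccos x)
    rw [cos_arccos hx.1 hx.2] at h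
    rw [h]; simp only [eval_pow, fejerPoly_eval_cos, hη]
  have hnn : ∀ j, ∀ x ∈ Set.Icc (-1 : ℝ) 1, 0 ≤ (φ j).eval x := by
    intro j x hx
    rw [hval j x hx]
    have := fejer_nonneg n (arccos x - η j)
    have := fejer_nonneg n (arccos x + η j)
    positivity
  have hdecay : ∀ j ∈ Finset.range (m * n), ∀ x ∈ Set.Icc (-1 : ℝ) 1,
      (φ j).eval x * angDist n x (ξ j) ^ (2 * m) ≤ K := by
    intro j hj x hx
    rw [hval j x hx, pow_mul, add_mul, ← mul_pow, ← mul_pow, hK, two_mul (22 ^ m : ℝ)]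
    unfold angDist
    rw [harc j hj]
    have h1 := fejer_nonneg n (arccos x - η j)
    have h2 := fejer_nonneg n (arccos x + η j)
    refine add_le_add (pow_le_pow_left₀ (by positivity) ?_ m) (pow_le_pow_left₀ (by positivity) ?_ m)
    · exact fejer_sub_le hn (arccos_mem x) (hη_mem j hj)
    · exact fejer_add_le hn (arccos_mem x) (hη_mem j hj)
  have hdist : ∀ j ∈ Finset.range (m * n), ∀ x, angDist n x (ξ j) =
      1 + π / m * |(arccos x * n * m / π - 1 / 2) - j| := by
    intro j hj x
    unfold angDist
    rw [harc j hj, hηn]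
    have e : arccos x - π / m * (j + 1 / 2) / n =
      (π / m / n) * ((arccos x * n * m / π - 1 / 2) - j) := by field_simp; ring
    rw [e, abs_mul, abs_of_pos (by positivity)]
    field_simp
  have hsumd : ∀ x, ∑ j ∈ Finset.range (m * n), 1 / angDist n x (ξ j) ^ 2 ≤ 4 * (m : ℝ) ^ 2 := by
    intro x
    calc _ ≤ ∑ j ∈ Finset.range (m * n),
          m ^ 2 * (1 / (1 + |(arccos x * n * m / π - 1 / 2) - j|) ^ 2) := by
          refine Finset.sum_le_sum fun j hj => ?_
          rw [hdist j hj]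
          set w := |(arccos x * n * m / π - 1 / 2) - j|
          have hw : 0 ≤ w := abs_nonneg _
          rw [mul_one_div, div_le_div_iff₀ (by positivity) (by positivity), one_mul, ← mul_pow]
          refine pow_le_pow_left₀ (by positivity) ?_ 2
          have : (m : ℝ) * (1 + π / m * w) = m + π * w := by field_simp
          rw [this]; nlinarith
      _ ≤ _ := by
          rw [← Finset.mul_sum, mul_comm (4 : ℝ)]
          gcongr
          exact sum_inv_one_add_abs_sq_le _ _
  have hnear : ∀ x ∈ Set.Icc (-1 : ℝ) 1, ∃ j ∈ Finset.range (m * n),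
      (1 / 4) ^ m ≤ (φ j).eval x ∧ angDist n x (ξ j) ≤ 5 := by
    intro x hx
    have ha := arccos_mem x
    obtain ⟨j, hj, hju⟩ := exists_near_node (N := m * n) (Nat.mul_pos hm hn)
      (u := arccos x * n * m / π - 1 / 2)
      (by have : 0 ≤ arccos x * n * m / π := by have := ha.1; positivity
          linarith)
      (by push_cast
          have : arccos x * n * m / π ≤ m * n := by
            rw [div_le_iff₀ pi_pos]
            have := mul_le_mul_of_nonneg_right ha.2 (show 0 ≤ (n : ℝ) * m by positivity)
            linarith
          linarith)
    have hj := Finset.mem_range.2 hj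
    have hd := hdist j hj x
    have hpm : π / m ≤ π := div_le_self pi_pos.le hmR
    have hb : π / m * |(arccos x * n * m / π - 1 / 2) - j| ≤ π * (1 / 2) := by gcongr
    refine ⟨j, hj, ?_, by rw [hd]; linarith⟩
    rw [hval j x hx]
    have h2 := pow_nonneg (fejer_nonneg n (arccos x + η j)) m
    have h1 := fejer_sub_ge hn (a := arccos x) (b := η j) (by
      unfold angDist at hd
      rw [harc j hj] at hd
      linarith)
    have h3 := pow_le_pow_left₀ (by norm_num) h1 m
    linarith
  have hZ : ∀ x, ∑ j ∈ Finset.range (m * n), (φ j).eval x = Z := by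
    intro x
    rw [← eval_finsetSum, hsum, eval_C]
  have hZlo : (1 / 4) ^ m ≤ Z := by
    obtain ⟨j, hj, h, _⟩ := hnear 1 (by norm_num)
    rw [← hZ 1]
    exact h.trans (Finset.single_le_sum (f := fun j => (φ j).eval 1)
      (fun i _ => hnn i 1 (by norm_num)) hj)
  have hZpos : 0 < Z := lt_of_lt_of_le (by positivity) hZlo
  have hZhi : Z ≤ K * (4 * m ^ 2) := by
    rw [← hZ 1]
    calc _ ≤ ∑ j ∈ Finset.range (m * n), K * (1 / angDist n 1 (ξ j) ^ 2) := by
          refine Finset.sum_le_sum fun j hj => ?_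
          have hd := one_le_angDist n 1 (ξ j)
          rw [mul_one_div, le_div_iff₀ (by positivity)]
          refine le_trans ?_ (hdecay j hj 1 (by norm_num))
          have := hnn j 1 (by norm_num)
          gcongr
          omega
      _ ≤ _ := by rw [← Finset.mul_sum]; gcongr; exact hsumd 1
  refine ⟨m * n, ξ, fun j => Polynomial.C (1 / Z) * φ j, ?_, ?_, ?_, ?_, ?_, ?_, ?_⟩
  · intro j _; exact ⟨neg_one_le_cos _, cos_le_one _⟩
  · intro j _; exact (natDegree_C_mul_le _ _).trans (hdeg j)
  · intro j _ x hx
    rw [eval_mul, eval_C]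
    have := hnn j x hx
    positivity
  · rw [← Finset.mul_sum, hsum, ← C_mul, one_div_mul_cancel hZpos.ne', C_1]
  · intro j hj x hx
    rw [eval_mul, eval_C, mul_assoc]
    have h1 : 1 / Z * ((φ j).eval x * angDist n x (ξ j) ^ (2 * m)) ≤ 1 / Z * K := by
      gcongr; exact hdecay j hj x hx
    have h2 : 1 / Z * K ≤ K / (1 / 4) ^ m := by
      rw [one_div_mul_eq_div]; gcongr
    have : 0 ≤ 4 * (m : ℝ) ^ 2 := by positivity
    linarith
  · intro x _
    have := hsumd x
    have : 0 ≤ K / (1 / 4) ^ m := by positivity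
    linarith
  · intro x hx
    obtain ⟨j, hj, h, hd⟩ := hnear x hx
    refine ⟨j, hj, ?_, hd⟩
    have h0 := hnn j x hx
    rw [eval_mul, eval_C, one_div_mul_eq_div]
    gcongr

lemma kernel_sum_le {m n N : ℕ} {C A x : ℝ} {ξ : ℕ → ℝ} {Φ w : ℕ → ℝ} (hA : 0 ≤ A) (hC : 0 ≤ C)
    (h0 : ∀ j ∈ Finset.range N, 0 ≤ Φ j)
    (h1 : ∀ j ∈ Finset.range N, Φ j * angDist n x (ξ j) ^ (2 * (m + 1)) ≤ C)
    (h2 : ∑ j ∈ Finset.range N, 1 / angDist n x (ξ j) ^ 2 ≤ C)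
    (hw : ∀ j ∈ Finset.range N, w j ≤ A * angDist n x (ξ j) ^ (2 * m)) :
    ∑ j ∈ Finset.range N, w j * Φ j ≤ A * C ^ 2 := by
  calc _ ≤ ∑ j ∈ Finset.range N, A * C * (1 / angDist n x (ξ j) ^ 2) := by
        refine Finset.sum_le_sum fun j hj => ?_
        have hd := angDist_pos n x (ξ j)
        rw [mul_one_div, le_div_iff₀ (by positivity)]
        calc w j * Φ j * angDist n x (ξ j) ^ 2
            ≤ A * angDist n x (ξ j) ^ (2 * m) * Φ j * angDist n x (ξ j) ^ 2 := by
              have := h0 j hj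
              gcongr
              exact hw j hj
          _ = A * (Φ j * angDist n x (ξ j) ^ (2 * (m + 1))) := by ring
          _ ≤ A * C := by gcongr; exact h1 j hj
    _ = A * C * ∑ j ∈ Finset.range N, 1 / angDist n x (ξ j) ^ 2 := by rw [Finset.mul_sum]
    _ ≤ A * C * C := by gcongr
    _ = _ := by ring

theorem exists_poly_equiv (E : ℕ) (B : ℝ) (hB : 0 < B) : ∃ C c : ℝ, 0 < C ∧ 0 < c ∧
    ∀ n : ℕ, 1 ≤ n → ∀ v : ℝ → ℝ, (∀ x ∈ Set.Icc (-1 : ℝ) 1, 0 ≤ v x) →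
    (∀ x ∈ Set.Icc (-1 : ℝ) 1, ∀ y ∈ Set.Icc (-1 : ℝ) 1, v x ≤ B * angDist n x y ^ E * v y) →
    ∃ V : ℝ[X], V.natDegree ≤ (E + 1) * n ∧
      ∀ x ∈ Set.Icc (-1 : ℝ) 1, c * v x ≤ V.eval x ∧ V.eval x ≤ C * v x := by
  obtain ⟨C, c, hC, hc, H⟩ := exists_kernel (E + 1) (by omega)
  refine ⟨B * C ^ 2, c / (B * 5 ^ E), by positivity, by positivity, fun n hn v hv hvs => ?_⟩
  obtain ⟨N, ξ, Φ, hξ, hdeg, hnn, -, hdec, hsd, hnear⟩ := H n hn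
  refine ⟨∑ j ∈ Finset.range N, Polynomial.C (v (ξ j)) * Φ j, ?_, fun x hx => ?_⟩
  · exact natDegree_sum_le_of_forall_le _ _ fun j hj => (natDegree_C_mul_le _ _).trans (hdeg j hj)
  · simp only [eval_finsetSum, eval_mul, eval_C]
    constructor
    · obtain ⟨j, hj, h1, h2⟩ := hnear x hx
      have h3 := Finset.single_le_sum (f := fun j => v (ξ j) * (Φ j).eval x)
        (fun i hi => mul_nonneg (hv _ (hξ i hi)) (hnn i hi x hx)) hj
      refine le_trans ?_ h3
      have h4 := hvs x hx (ξ j) (hξ j hj)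
      have h5 := hv _ (hξ j hj)
      have hd := angDist_pos n x (ξ j)
      rw [div_mul_eq_mul_div, div_le_iff₀ (by positivity)]
      calc c * v x ≤ c * (B * 5 ^ E * v (ξ j)) := by
            gcongr; refine h4.trans ?_; gcongr
        _ = v (ξ j) * c * (B * 5 ^ E) := by ring
        _ ≤ v (ξ j) * (Φ j).eval x * (B * 5 ^ E) := by gcongr
    · have := kernel_sum_le (m := E) (A := B * v x) (by have := hv x hx; positivity) hC.le
        (fun j hj => hnn j hj x hx) (fun j hj => hdec j hj x hx) (hsd x hx) (w := fun j => v (ξ j))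
        (fun j hj => by
          have h := hvs (ξ j) (hξ j hj) x hx
          rw [angDist_comm] at h
          have hd := one_le_angDist n x (ξ j)
          have hv0 := hv x hx
          calc v (ξ j) ≤ B * angDist n x (ξ j) ^ E * v x := h
            _ ≤ B * angDist n x (ξ j) ^ (2 * E) * v x := by gcongr; omega
            _ = _ := by ring)
      linarith

theorem exists_poly_approx (E L : ℕ) (B : ℝ) (hB : 0 < B) : ∃ C : ℝ, 0 < C ∧
    ∀ n : ℕ, 1 ≤ n → ∀ (f Ψ : ℝ → ℝ) (q : ℝ → ℝ[X]), (∀ x ∈ Set.Icc (-1 : ℝ) 1, 0 ≤ Ψ x) →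
    (∀ x ∈ Set.Icc (-1 : ℝ) 1, ∀ y ∈ Set.Icc (-1 : ℝ) 1, Ψ x ≤ B * angDist n x y ^ E * Ψ y) →
    (∀ y ∈ Set.Icc (-1 : ℝ) 1, (q y).natDegree ≤ L) →
    (∀ x ∈ Set.Icc (-1 : ℝ) 1, ∀ y ∈ Set.Icc (-1 : ℝ) 1,
      |f x - (q y).eval x| ≤ B * Ψ y * angDist n x y ^ E) →
    ∃ Q : ℝ[X], Q.natDegree ≤ (E + 1) * n + L ∧
      ∀ x ∈ Set.Icc (-1 : ℝ) 1, |f x - Q.eval x| ≤ C * Ψ x := by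
  obtain ⟨C, c, hC, hc, H⟩ := exists_kernel (E + 1) (by omega)
  refine ⟨B ^ 2 * C ^ 2, by positivity, fun n hn f Ψ q hΨ hΨs hq hfq => ?_⟩
  obtain ⟨N, ξ, Φ, hξ, hdeg, hnn, hone, hdec, hsd, -⟩ := H n hn
  refine ⟨∑ j ∈ Finset.range N, q (ξ j) * Φ j, ?_, fun x hx => ?_⟩
  · refine natDegree_sum_le_of_forall_le _ _ fun j hj => natDegree_mul_le.trans ?_
    have := hdeg j hj
    have := hq _ (hξ j hj)
    omega
  · have h1 : ∑ j ∈ Finset.range N, (Φ j).eval x = 1 := by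
      rw [← eval_finsetSum, hone, eval_one]
    have h2 : f x - (∑ j ∈ Finset.range N, q (ξ j) * Φ j).eval x =
        ∑ j ∈ Finset.range N, (f x - (q (ξ j)).eval x) * (Φ j).eval x := by
      simp only [eval_finsetSum, eval_mul, sub_mul, Finset.sum_sub_distrib]
      rw [← Finset.mul_sum, h1, mul_one]
    rw [h2]
    refine (Finset.abs_sum_le_sum_abs _ _).trans ?_
    have h3 := kernel_sum_le (m := E) (A := B ^ 2 * Ψ x) (by have := hΨ x hx; positivity) hC.le
        (fun j hj => hnn j hj x hx) (fun j hj => hdec j hj x hx) (hsd x hx)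
        (w := fun j => |f x - (q (ξ j)).eval x|)
        (fun j hj => by
          have h := hΨs (ξ j) (hξ j hj) x hx
          rw [angDist_comm] at h
          have hd := angDist_pos n x (ξ j)
          calc _ ≤ B * Ψ (ξ j) * angDist n x (ξ j) ^ E := hfq x hx _ (hξ j hj)
            _ ≤ B * (B * angDist n x (ξ j) ^ E * Ψ x) * angDist n x (ξ j) ^ E := by gcongr
            _ = _ := by ring)
    calc _ = ∑ j ∈ Finset.range N, |f x - (q (ξ j)).eval x| * (Φ j).eval x := by
          refine Finset.sum_congr rfl fun j hj => ?_
          rw [abs_mul, abs_of_nonneg (hnn j hj x hx)]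
      _ ≤ _ := h3
      _ = _ := by ring

/-- The symmetrised Fejér kernel centred at `α`, as an algebraic polynomial. -/
noncomputable def peak (n : ℕ) (α : ℝ) : ℝ[X] :=
  C (2 / (n : ℝ) ^ 2) * ∑ l ∈ Finset.range n, ∑ l' ∈ Finset.range n,
    C (cos ((((l : ℤ) - (l' : ℤ) : ℤ) : ℝ) * arccos α)) * Chebyshev.T ℝ ((l : ℤ) - (l' : ℤ))

lemma peak_natDegree_le (n : ℕ) (α : ℝ) : (peak n α).natDegree ≤ n := by
  unfold peak
  refine (natDegree_C_mul_le _ _).trans ?_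
  refine natDegree_sum_le_of_forall_le _ _ fun l hl => ?_
  refine natDegree_sum_le_of_forall_le _ _ fun l' hl' => ?_
  refine (natDegree_C_mul_le _ _).trans ?_
  rw [Chebyshev.natDegree_T]
  have := Finset.mem_range.1 hl
  have := Finset.mem_range.1 hl'
  omega

section
variable {n : ℕ} (hn : 1 ≤ n) {x α : ℝ} (hx : x ∈ Set.Icc (-1 : ℝ) 1) (hα : α ∈ Set.Icc (-1 : ℝ) 1)

include hx in
lemma peak_eval : (peak n α).eval x = 2 / (n : ℝ) ^ 2 * ∑ l ∈ Finset.range n, ∑ l' ∈ Finset.range n,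
    cos ((((l : ℤ) - (l' : ℤ) : ℤ) : ℝ) * arccos α) *
      cos ((((l : ℤ) - (l' : ℤ) : ℤ) : ℝ) * arccos x) := by
  conv_lhs => rw [← cos_arccos hx.1 hx.2]
  unfold peak
  simp only [eval_mul, eval_C, eval_finsetSum, Chebyshev.T_real_cos]

include hx in
lemma peak_eval_eq_fejer : (peak n α).eval x =
    fejer n (arccos x - arccos α) + fejer n (arccos x + arccos α) := by
  rw [peak_eval hx, fejer_eq_sum, fejer_eq_sum, ← mul_add, ← Finset.sum_add_distrib]
  rw [show (2 : ℝ) / (n : ℝ) ^ 2 = 1 / (n : ℝ) ^ 2 * 2 by ring, mul_assoc, Finset.mul_sum]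
  congr 1
  refine Finset.sum_congr rfl fun l _ => ?_
  rw [← Finset.sum_add_distrib, Finset.mul_sum]
  refine Finset.sum_congr rfl fun l' _ => ?_
  rw [mul_sub, mul_add, cos_sub, cos_add]; ring

include hx in
lemma peak_nonneg : 0 ≤ (peak n α).eval x := by
  rw [peak_eval_eq_fejer hx]; exact add_nonneg (fejer_nonneg _ _) (fejer_nonneg _ _)

include hn hα in
lemma one_le_peak_self : 1 ≤ (peak n α).eval α := by
  rw [peak_eval_eq_fejer hα, sub_self, fejer_zero hn]
  linarith [fejer_nonneg n (arccos α + arccos α)]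

include hn hx in
lemma peak_mul_le : (peak n α).eval x * angDist n x α ^ 2 ≤ 44 := by
  rw [peak_eval_eq_fejer hx, add_mul]
  have h1 := fejer_sub_le hn (arccos_mem x) (arccos_mem α)
  have h2 := fejer_add_le hn (arccos_mem x) (arccos_mem α)
  unfold angDist; linarith

include hn hx hα in
lemma abs_peak_sub_le : |(peak n α).eval x - (peak n α).eval α| ≤ 8 * (|x - α| / rho n α) := by
  have h0 : (0 : ℝ) < n := by exact_mod_cast hn
  rw [peak_eval hx, peak_eval hα, ← mul_sub, ← Finset.sum_sub_distrib, abs_mul,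
    abs_of_pos (by positivity)]
  have h : |∑ l ∈ Finset.range n,
      (∑ l' ∈ Finset.range n, cos ((((l : ℤ) - (l' : ℤ) : ℤ) : ℝ) * arccos α) *
      cos ((((l : ℤ) - (l' : ℤ) : ℤ) : ℝ) * arccos x) -
      ∑ l' ∈ Finset.range n, cos ((((l : ℤ) - (l' : ℤ) : ℤ) : ℝ) * arccos α) *
      cos ((((l : ℤ) - (l' : ℤ) : ℤ) : ℝ) * arccos α))| ≤
      ∑ l ∈ Finset.range n, ∑ l' ∈ Finset.range n, 4 * (|x - α| / rho n α) := by
    refine (Finset.abs_sum_le_sum_abs _ _).trans (Finset.sum_le_sum fun l hl => ?_)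
    rw [← Finset.sum_sub_distrib]
    refine (Finset.abs_sum_le_sum_abs _ _).trans (Finset.sum_le_sum fun l' hl' => ?_)
    rw [← mul_sub, abs_mul]
    have hz : |(((l : ℤ) - (l' : ℤ) : ℤ) : ℝ)| ≤ n := by
      have := Finset.mem_range.1 hl
      have := Finset.mem_range.1 hl'
      rw [← Int.cast_abs]
      have : |(l : ℤ) - (l' : ℤ)| ≤ n := by rw [abs_le]; constructor <;> omega
      exact_mod_cast this
    have h1 := abs_cos_int_mul_sub_le hn hx hα _ hz
    have h2 := abs_cos_le_one ((((l : ℤ) - (l' : ℤ) : ℤ) : ℝ) * arccos α)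
    have h3 := abs_nonneg (cos ((((l : ℤ) - (l' : ℤ) : ℤ) : ℝ) * arccos x) -
      cos ((((l : ℤ) - (l' : ℤ) : ℤ) : ℝ) * arccos α))
    nlinarith
  calc _ ≤ 2 / (n : ℝ) ^ 2 * ∑ l ∈ Finset.range n, ∑ l' ∈ Finset.range n, 4 * (|x - α| / rho n α) := by
        gcongr
    _ = _ := by
        simp only [Finset.sum_const, Finset.card_range, nsmul_eq_mul]
        field_simp; ring

end

lemma abs_mul_sub_one_le {a b A B t : ℝ} (ht : 0 ≤ t) (ht1 : t ≤ 1) (hA : 0 ≤ A) (hB : 0 ≤ B)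
    (ha : |a - 1| ≤ A * t) (hb : |b - 1| ≤ B * t) : |a * b - 1| ≤ ((1 + A) * (1 + B) - 1) * t := by
  have e : a * b - 1 = (a - 1) * (b - 1) + (a - 1) + (b - 1) := by ring
  rw [e]
  have h1 : |(a - 1) * (b - 1)| ≤ (A * t) * (B * t) := by
    rw [abs_mul]; gcongr
  have h2 := abs_add_three ((a - 1) * (b - 1)) (a - 1) (b - 1)
  have h3 : (A * t) * (B * t) ≤ A * B * t := by
    have : A * B * t * t ≤ A * B * t * 1 := by gcongr
    linarith
  linarith

lemma abs_pow_sub_one_le {a A t : ℝ} (ht : 0 ≤ t) (ht1 : t ≤ 1) (hA : 0 ≤ A)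
    (ha : |a - 1| ≤ A * t) (m : ℕ) : |a ^ m - 1| ≤ ((1 + A) ^ m - 1) * t := by
  induction m with
  | zero => simp
  | succ m ih =>
    have h1 : 1 ≤ (1 + A) ^ m := one_le_pow₀ (by linarith)
    have := abs_mul_sub_one_le ht ht1 (by linarith) hA ih ha
    rw [pow_succ, pow_succ]
    refine this.trans (le_of_eq ?_)
    ring

lemma abs_prod_sub_one_le {ι : Type*} (s : Finset ι) {a : ι → ℝ} {A t : ℝ} (ht : 0 ≤ t) (ht1 : t ≤ 1)
    (hA : 0 ≤ A) (ha : ∀ i ∈ s, |a i - 1| ≤ A * t) :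
    |∏ i ∈ s, a i - 1| ≤ ((1 + A) ^ s.card - 1) * t := by
  classical
  induction s using Finset.induction_on with
  | empty => simp
  | insert i s hi ih =>
    have h1 : 1 ≤ (1 + A) ^ s.card := one_le_pow₀ (by linarith)
    have := abs_mul_sub_one_le ht ht1 hA (by linarith) (ha i (Finset.mem_insert_self i s))
      (ih fun j hj => ha j (Finset.mem_insert_of_mem hj))
    rw [Finset.prod_insert hi, Finset.card_insert_of_notMem hi]
    refine this.trans (le_of_eq ?_)
    ring

/-- A product of a power of the normalised peak at `α` with the fundamental Lagrange polynomial of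
`S` at `α`. -/
noncomputable def lagrangePeak (n m : ℕ) (S : Finset ℝ) (α : ℝ) : ℝ[X] :=
  (C (1 / (peak n α).eval α) * peak n α) ^ m * ∏ β ∈ S.erase α, (C (1 / (α - β)) * (X - C β))

lemma lagrangePeak_natDegree_le (n m : ℕ) (S : Finset ℝ) (α : ℝ) :
    (lagrangePeak n m S α).natDegree ≤ m * n + S.card := by
  unfold lagrangePeak
  refine natDegree_mul_le.trans (add_le_add ?_ ?_)
  · exact natDegree_pow_le_of_le m ((natDegree_C_mul_le _ _).trans (peak_natDegree_le n α))
  · refine (natDegree_prod_le _ _).trans ?_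
    calc _ ≤ ∑ β ∈ S.erase α, 1 := Finset.sum_le_sum fun β _ =>
          (natDegree_C_mul_le _ _).trans (natDegree_X_sub_C_le _)
      _ ≤ S.card := by rw [← Finset.card_eq_sum_ones]; exact Finset.card_erase_le

section
variable {n : ℕ} (hn : 1 ≤ n) (m : ℕ) {S : Finset ℝ} (hS : ∀ α ∈ S, α ∈ Set.Icc (-1 : ℝ) 1)
  (hsep : ∀ α ∈ S, ∀ β ∈ S, α ≠ β → 2 / (n : ℝ) ≤ |α - β|) {α : ℝ} (hα : α ∈ S)
  {x : ℝ} (hx : x ∈ Set.Icc (-1 : ℝ) 1)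

lemma lagrangePeak_eval : (lagrangePeak n m S α).eval x =
    ((peak n α).eval x / (peak n α).eval α) ^ m * ∏ β ∈ S.erase α, ((x - β) / (α - β)) := by
  unfold lagrangePeak
  simp only [eval_mul, eval_pow, eval_C, eval_prod, eval_sub, eval_X]
  simp only [one_div_mul_eq_div]

include hn hS hα in
lemma lagrangePeak_self : (lagrangePeak n m S α).eval α = 1 := by
  have h := one_le_peak_self hn (hS α hα)
  rw [lagrangePeak_eval, div_self (by linarith), one_pow, one_mul]
  refine Finset.prod_eq_one fun β hβ => div_self (sub_ne_zero.2 (Finset.ne_of_mem_erase hβ).symm)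

lemma dvd_lagrangePeak {β : ℝ} (hβ : β ∈ S) (h : β ≠ α) : (X - C β) ∣ lagrangePeak n m S α :=
  Dvd.dvd.mul_left ((Dvd.intro_left _ rfl).trans
    (Finset.dvd_prod_of_mem (fun β => C (1 / (α - β)) * (X - C β)) (Finset.mem_erase.2 ⟨h, hβ⟩))) _

include hn hsep hα in
lemma abs_div_sub_le {β : ℝ} (hβ : β ∈ S.erase α) {u y : ℝ} (hu : 0 ≤ u) :
    u / |α - β| ≤ u / rho n y := by
  have h1 := hsep α hα β (Finset.mem_of_mem_erase hβ) (Finset.ne_of_mem_erase hβ).symm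
  have h2 := rho_pos hn y
  have h3 := rho_le hn y
  gcongr
  linarith

include hn hS hsep hα hx

lemma abs_ratio_le {β : ℝ} (hβ : β ∈ S.erase α) :
    |(x - β) / (α - β)| ≤ 2 * angDist n x α ^ 2 := by
  have hne : 0 < |α - β| := abs_pos.2 (sub_ne_zero.2 (Finset.ne_of_mem_erase hβ).symm)
  have h1 := abs_div_sub_le hn hsep hα hβ (abs_nonneg (x - α)) (y := α)
  have h2 := abs_sub_le_rho_mul hn hx (hS α hα)
  have h3 := one_le_angDist n x α
  have hr := rho_pos hn α
  have h4 : |x - α| / rho n α ≤ angDist n x α ^ 2 := by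
    rw [div_le_iff₀ hr]; linarith
  have h5 : |(x - β) / (α - β)| ≤ 1 + |x - α| / |α - β| := by
    rw [abs_div, div_le_iff₀ hne, add_mul, div_mul_cancel₀ _ hne.ne', one_mul, add_comm]
    exact abs_sub_le x α β
  nlinarith

omit hsep in
lemma abs_normalized_peak_le :
    |(peak n α).eval x / (peak n α).eval α| ≤ 44 / angDist n x α ^ 2 := by
  have h1 := one_le_peak_self hn (hS α hα)
  have h2 := peak_nonneg (n := n) (α := α) hx
  have h3 := peak_mul_le hn (α := α) hx
  have hd := angDist_pos n x α
  rw [abs_of_nonneg (by positivity)]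
  refine (div_le_self h2 h1).trans ?_
  rw [le_div_iff₀ (by positivity)]; exact h3

lemma abs_lagrangePeak_le : |(lagrangePeak n (m + S.card) S α).eval x| * angDist n x α ^ (2 * m) ≤
    44 ^ (m + S.card) * 2 ^ S.card := by
  have hd := one_le_angDist n x α
  rw [lagrangePeak_eval, abs_mul, abs_pow, Finset.abs_prod]
  have h1 := abs_normalized_peak_le hn hS hα hx
  have h2 : ∏ β ∈ S.erase α, |(x - β) / (α - β)| ≤ (2 * angDist n x α ^ 2) ^ S.card := by
    calc _ ≤ ∏ β ∈ S.erase α, (2 * angDist n x α ^ 2) :=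
          Finset.prod_le_prod (fun β _ => abs_nonneg _) fun β hβ => abs_ratio_le hn hS hsep hα hx hβ
      _ ≤ _ := by
          rw [Finset.prod_const]
          exact pow_le_pow_right₀ (by nlinarith) (Finset.card_erase_le)
  calc _ ≤ (44 / angDist n x α ^ 2) ^ (m + S.card) * (2 * angDist n x α ^ 2) ^ S.card *
        angDist n x α ^ (2 * m) := by gcongr
    _ = _ := by
        rw [div_pow, mul_pow, pow_add _ m, pow_add _ m, pow_mul]
        field_simp

lemma abs_lagrangePeak_le_of_near {β : ℝ} (hβ : β ∈ S.erase α) :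
    |(lagrangePeak n (m + S.card) S α).eval x| * angDist n x α ^ (2 * m) ≤
    44 ^ (m + S.card) * 2 ^ S.card * (|x - β| / rho n β) := by
  have hd := one_le_angDist n x α
  rw [lagrangePeak_eval, abs_mul, abs_pow, Finset.abs_prod, ← Finset.mul_prod_erase _ _ hβ]
  have h1 := abs_normalized_peak_le hn hS hα hx
  have h2 : ∏ β ∈ (S.erase α).erase β, |(x - β) / (α - β)| ≤ (2 * angDist n x α ^ 2) ^ S.card := by
    calc _ ≤ ∏ β ∈ (S.erase α).erase β, (2 * angDist n x α ^ 2) :=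
          Finset.prod_le_prod (fun β _ => abs_nonneg _) fun β hβ =>
            abs_ratio_le hn hS hsep hα hx (Finset.mem_of_mem_erase hβ)
      _ ≤ _ := by
          rw [Finset.prod_const]
          exact pow_le_pow_right₀ (by nlinarith)
            ((Finset.card_erase_le).trans (Finset.card_erase_le))
  have h3 : |(x - β) / (α - β)| ≤ |x - β| / rho n β := by
    rw [abs_div]; exact abs_div_sub_le hn hsep hα hβ (abs_nonneg _)
  have hr := rho_pos hn β
  calc _ ≤ (44 / angDist n x α ^ 2) ^ (m + S.card) *
        ((|x - β| / rho n β) * (2 * angDist n x α ^ 2) ^ S.card) *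
        angDist n x α ^ (2 * m) := by gcongr
    _ = _ := by
        rw [div_pow, mul_pow, pow_add _ m, pow_add _ m, pow_mul]
        field_simp

lemma abs_lagrangePeak_sub_one_le (h : |x - α| ≤ rho n α) :
    |(lagrangePeak n m S α).eval x - 1| ≤ 9 ^ (m + S.card) * (|x - α| / rho n α) := by
  have hr := rho_pos hn α
  set t := |x - α| / rho n α
  have ht : 0 ≤ t := by positivity
  have ht1 : t ≤ 1 := (div_le_one hr).2 h
  have hp := one_le_peak_self hn (hS α hα)
  have h1 : |(peak n α).eval x / (peak n α).eval α - 1| ≤ 8 * t := by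
    rw [div_sub_one (by linarith), abs_div, abs_of_pos (by linarith : 0 < (peak n α).eval α)]
    exact (div_le_self (abs_nonneg _) hp).trans (abs_peak_sub_le hn hx (hS α hα))
  have h2 : ∀ β ∈ S.erase α, |(x - β) / (α - β) - 1| ≤ 8 * t := by
    intro β hβ
    have hne : α - β ≠ 0 := sub_ne_zero.2 (Finset.ne_of_mem_erase hβ).symm
    rw [div_sub_one hne, abs_div, sub_sub_sub_cancel_right]
    have := abs_div_sub_le hn hsep hα hβ (abs_nonneg (x - α)) (y := α)
    linarith
  have h3 := abs_pow_sub_one_le ht ht1 (by norm_num) h1 m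
  have h4 := abs_prod_sub_one_le _ ht ht1 (by norm_num) h2
  have e1 : (1 : ℝ) ≤ (1 + 8) ^ m := one_le_pow₀ (by norm_num)
  have e2 : (1 : ℝ) ≤ (1 + 8) ^ (S.erase α).card := one_le_pow₀ (by norm_num)
  rw [lagrangePeak_eval]
  refine (abs_mul_sub_one_le ht ht1 (by linarith) (by linarith) h3 h4).trans ?_
  gcongr
  have : (9 : ℝ) ^ (S.erase α).card ≤ 9 ^ S.card :=
    pow_le_pow_right₀ (by norm_num) Finset.card_erase_le
  calc _ ≤ (9 : ℝ) ^ m * 9 ^ (S.erase α).card := by norm_num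
    _ ≤ _ := by rw [pow_add]; gcongr

end

lemma abs_one_sub_one_sub_pow_le {b K : ℝ} (hb : |b| ≤ K) (M : ℕ) :
    |1 - (1 - b) ^ M| ≤ M * (1 + K) ^ M * |b| := by
  have hK : 0 ≤ K := (abs_nonneg b).trans hb
  induction M with
  | zero => simp
  | succ M ih =>
    have e : 1 - (1 - b) ^ (M + 1) = (1 - (1 - b) ^ M) + (1 - b) ^ M * b := by ring
    rw [e]
    refine (abs_add_le _ _).trans ?_
    have h1 : |(1 - b) ^ M * b| ≤ (1 + K) ^ M * |b| := by
      rw [abs_mul, abs_pow]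
      gcongr
      refine (abs_sub _ _).trans ?_
      rw [abs_one]; linarith
    have h2 : (1 + K) ^ M ≤ (1 + K) ^ (M + 1) := pow_le_pow_right₀ (by linarith) (by omega)
    have h3 := mul_le_mul_of_nonneg_right h2 (show 0 ≤ (M + 1) * |b| by positivity)
    push_cast
    nlinarith

theorem exists_hermite_peak (s m M : ℕ) (hM : 1 ≤ M) : ∃ (K : ℝ) (D : ℕ), 0 < K ∧
    ∀ n : ℕ, 1 ≤ n → ∀ S : Finset ℝ, S.card ≤ s → (∀ α ∈ S, α ∈ Set.Icc (-1 : ℝ) 1) →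
    (∀ α ∈ S, ∀ β ∈ S, α ≠ β → 2 / (n : ℝ) ≤ |α - β|) →
    ∃ Λ : ℝ → ℝ[X], ∀ α ∈ S, (Λ α).natDegree ≤ D * n ∧ (X - C α) ^ M ∣ 1 - Λ α ∧
      (∀ β ∈ S, β ≠ α → (X - C β) ^ M ∣ Λ α) ∧
      (∀ x ∈ Set.Icc (-1 : ℝ) 1, |(Λ α).eval x| * angDist n x α ^ m ≤ K) ∧
      (∀ x ∈ Set.Icc (-1 : ℝ) 1, |x - α| ≤ rho n α →
        |1 - (Λ α).eval x| ≤ K * (|x - α| / rho n α) ^ M) ∧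
      (∀ β ∈ S, β ≠ α → ∀ x ∈ Set.Icc (-1 : ℝ) 1,
        |(Λ α).eval x| * angDist n x α ^ m ≤ K * (|x - β| / rho n β) ^ M) := by
  set A : ℝ := 44 ^ (m + s) * 2 ^ s with hA
  have hA1 : 1 ≤ A := one_le_mul_of_one_le_of_one_le (one_le_pow₀ (by norm_num))
    (one_le_pow₀ (by norm_num))
  set G : ℝ := M * (1 + A ^ M) ^ M with hG
  have hG0 : 0 < G := by positivity
  set H : ℝ := (M * (1 + (1 + A)) ^ M * 9 ^ (m + s + s)) ^ M with hH
  have hH0 : 0 < H := by positivity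
  refine ⟨G * A ^ M + H, M * (M * (m + s + s)), by positivity, fun n hn S hs hS hsep => ?_⟩
  have hpow : (44 : ℝ) ^ (m + S.card) * 2 ^ S.card ≤ A := by
    rw [hA]; gcongr <;> norm_num
  have hsmall : ∀ a u D : ℝ, 1 ≤ D → 0 ≤ u → u ≤ A → |a| * D ^ 2 ≤ u →
      |1 - (1 - a ^ M) ^ M| * D ≤ G * u ^ M := by
    intro a u D hD hu0 huA h
    have h1 : |a| * D ≤ u := by
      refine le_trans ?_ h
      gcongr; nlinarith
    have ha : |a| ≤ u := by
      refine le_trans ?_ h1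
      have := abs_nonneg a
      nlinarith
    have hb : |a ^ M| ≤ A ^ M := by
      rw [abs_pow]; exact pow_le_pow_left₀ (abs_nonneg a) (ha.trans huA) M
    have h2 := abs_one_sub_one_sub_pow_le hb M
    calc _ ≤ M * (1 + A ^ M) ^ M * |a ^ M| * D := by gcongr
      _ ≤ G * (|a| * D) ^ M := by
        rw [abs_pow, mul_pow |a|, ← hG, mul_assoc]
        gcongr
        exact le_self_pow₀ hD (by omega)
      _ ≤ _ := by gcongr
  refine ⟨fun α => 1 - (1 - lagrangePeak n (m + S.card) S α ^ M) ^ M, fun α hα =>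
    ⟨?_, ?_, ?_, ?_, ?_, ?_⟩⟩
  · have h1 := lagrangePeak_natDegree_le n (m + S.card) S α
    have h2 : (1 - lagrangePeak n (m + S.card) S α ^ M).natDegree ≤
        M * ((m + S.card) * n + S.card) :=
      (natDegree_sub_le _ _).trans (max_le (by simp) (natDegree_pow_le_of_le M h1))
    refine (natDegree_sub_le _ _).trans (max_le (by simp) ((natDegree_pow_le_of_le M h2).trans ?_))
    rw [mul_assoc, mul_assoc]
    gcongr
    calc _ ≤ (m + s) * n + s * n := by
          gcongr
          exact hs.trans (Nat.le_mul_of_pos_right _ hn)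
      _ = _ := by ring
  · rw [sub_sub_cancel]
    refine pow_dvd_pow_of_dvd ?_ M
    rw [dvd_iff_isRoot, IsRoot.def, eval_sub, eval_one, eval_pow, lagrangePeak_self hn _ hS hα,
      one_pow, sub_self]
  · intro β hβ hne
    have h1 : lagrangePeak n (m + S.card) S α ^ M ∣
        1 - (1 - lagrangePeak n (m + S.card) S α ^ M) ^ M := by
      have := sub_dvd_pow_sub_pow (1 : ℝ[X]) (1 - lagrangePeak n (m + S.card) S α ^ M) M
      rwa [one_pow, sub_sub_cancel] at this
    exact (pow_dvd_pow_of_dvd (dvd_lagrangePeak _ hβ hne) M).trans h1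
  · intro x hx
    have h := (abs_lagrangePeak_le hn m hS hsep hα hx).trans hpow
    rw [mul_comm 2, pow_mul] at h
    have := hsmall _ A _ (one_le_pow₀ (one_le_angDist n x α)) (by linarith) le_rfl h
    simp only [eval_sub, eval_one, eval_pow]
    linarith
  · intro x hx hnear
    have h := abs_lagrangePeak_sub_one_le hn (m + S.card) hS hsep hα hx hnear
    have hr := rho_pos hn α
    simp only [eval_sub, eval_one, eval_pow, sub_sub_cancel]
    set a := (lagrangePeak n (m + S.card) S α).eval x
    have ha : |a| ≤ A := by
      refine le_trans ?_ ((abs_lagrangePeak_le hn m hS hsep hα hx).trans hpow)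
      exact le_mul_of_one_le_right (abs_nonneg _) (one_le_pow₀ (one_le_angDist n x α))
    have h1 : |1 - a| ≤ 1 + A := (abs_sub _ _).trans (by rw [abs_one]; linarith)
    have h2 := abs_one_sub_one_sub_pow_le h1 M
    rw [sub_sub_cancel] at h2
    rw [abs_pow]
    calc |1 - a ^ M| ^ M ≤ (M * (1 + (1 + A)) ^ M * (9 ^ (m + s + s) * (|x - α| / rho n α))) ^ M := by
          gcongr
          refine h2.trans ?_
          rw [abs_sub_comm]
          gcongr
          refine h.trans ?_
          gcongr
          norm_num
      _ = H * (|x - α| / rho n α) ^ M := by rw [hH, ← mul_pow]; congr 1; ring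
      _ ≤ _ := by gcongr; linarith [show 0 < G * A ^ M by positivity]
  · intro β hβ hne x hx
    have hr := rho_pos hn β
    set t := |x - β| / rho n β
    have ht : 0 ≤ t := by positivity
    have h0 := (abs_lagrangePeak_le hn m hS hsep hα hx).trans hpow
    have h := abs_lagrangePeak_le_of_near hn m hS hsep hα hx (Finset.mem_erase.2 ⟨hne, hβ⟩)
    rw [mul_comm 2, pow_mul] at h h0
    have h' := h.trans (mul_le_mul_of_nonneg_right hpow ht)
    simp only [eval_sub, eval_one, eval_pow]
    have hD := one_le_pow₀ (n := m) (one_le_angDist n x α)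
    rcases le_total t 1 with h1 | h1
    · have := hsmall _ (A * t) _ hD (by positivity) (by nlinarith) h'
      refine this.trans ?_
      rw [mul_pow, ← mul_assoc]
      gcongr; linarith
    · have := hsmall _ A _ hD (by linarith) le_rfl h0
      have h2 : 1 ≤ t ^ M := one_le_pow₀ h1
      have : 0 < G * A ^ M := by positivity
      nlinarith

/-- The distance from `x` to `α`, smoothed at the scale `rho n α`. -/
noncomputable def offset (n : ℕ) (α x : ℝ) : ℝ := |x - α| + rho n α

lemma offset_pos {n : ℕ} (hn : 1 ≤ n) (α x : ℝ) : 0 < offset n α x :=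
  add_pos_of_nonneg_of_pos (abs_nonneg _) (rho_pos hn α)

lemma offset_le {n : ℕ} (hn : 1 ≤ n) {x y α : ℝ} (hx : x ∈ Set.Icc (-1 : ℝ) 1)
    (hy : y ∈ Set.Icc (-1 : ℝ) 1) (hα : α ∈ Set.Icc (-1 : ℝ) 1) :
    offset n α y ≤ 5 * angDist n x y ^ 2 * offset n α x := by
  unfold offset
  have h1 := abs_sub_le_rho_mul hn hy hx
  have h2 := rho_le_abs_sub_add hn hx hα
  have h3 := abs_sub_le y x α
  have hd := one_le_angDist n x y
  rw [angDist_comm] at h1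
  have hr := rho_pos hn α
  have hd2 : 1 ≤ angDist n x y ^ 2 := one_le_pow₀ hd
  have h4 := mul_le_mul_of_nonneg_right h2 (show 0 ≤ angDist n x y ^ 2 by positivity)
  have h5 := mul_le_mul_of_nonneg_right hd2 (show 0 ≤ |x - α| + rho n α by positivity)
  nlinarith

/-- The product of the damping factors `(|x - α| / offset)^μ` over the nodes. -/
noncomputable def damping (n : ℕ) (S : Finset ℝ) (μ : ℝ → ℕ) (x : ℝ) : ℝ :=
  ∏ α ∈ S, (|x - α| / offset n α x) ^ μ α

section
variable {n s M : ℕ} (hn : 1 ≤ n) {S : Finset ℝ} (hs : S.card ≤ s) {μ : ℝ → ℕ}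
  (hμ : ∀ α ∈ S, μ α ≤ M)
include hn

lemma damping_nonneg (x : ℝ) : 0 ≤ damping n S μ x :=
  Finset.prod_nonneg fun α _ => pow_nonneg (div_nonneg (abs_nonneg _) (offset_pos hn α x).le) _

lemma damping_le_one (x : ℝ) : damping n S μ x ≤ 1 := by
  refine Finset.prod_le_one
    (fun α _ => pow_nonneg (div_nonneg (abs_nonneg _) (offset_pos hn α x).le) _) fun α _ => ?_
  refine pow_le_one₀ (div_nonneg (abs_nonneg _) (offset_pos hn α x).le) ?_
  rw [div_le_one (offset_pos hn α x)]
  unfold offset; linarith [rho_pos hn α]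

include hs hμ

lemma pow_le_damping_of_far {T : Finset ℝ} (hT : T ⊆ S) {x : ℝ} (h : ∀ α ∈ T, rho n α ≤ |x - α|) :
    (1 / 2) ^ (M * s) ≤ damping n T μ x := by
  calc ((1 : ℝ) / 2) ^ (M * s) ≤ (1 / 2) ^ (M * T.card) :=
        pow_le_pow_of_le_one (by norm_num) (by norm_num)
          (Nat.mul_le_mul_left _ ((Finset.card_le_card hT).trans hs))
    _ = ∏ α ∈ T, (1 / 2) ^ M := by rw [Finset.prod_const, pow_mul]
    _ ≤ _ := by
        refine Finset.prod_le_prod (fun _ _ => by positivity) fun α hα => ?_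
        calc ((1 : ℝ) / 2) ^ M ≤ (1 / 2) ^ μ α :=
              pow_le_pow_of_le_one (by norm_num) (by norm_num) (hμ α (hT hα))
          _ ≤ _ := by
              refine pow_le_pow_left₀ (by norm_num) ?_ _
              rw [le_div_iff₀ (offset_pos hn α x)]
              unfold offset; linarith [h α hα]

lemma pow_le_damping_of_near (hS6 : ∀ α ∈ S, ∀ β ∈ S, α ≠ β → 6 / (n : ℝ) ≤ |α - β|)
    {α x : ℝ} (hα : α ∈ S) (hx : |x - α| ≤ rho n α) :
    (1 / 2) ^ (M * s) * (1 / 2) ^ M * (|x - α| / rho n α) ^ μ α ≤ damping n S μ x := by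
  have hr := rho_pos hn α
  unfold damping
  rw [← Finset.mul_prod_erase _ _ hα, mul_assoc, mul_comm]
  refine mul_le_mul ?_ ?_ (by positivity)
    (pow_nonneg (div_nonneg (abs_nonneg _) (offset_pos hn α x).le) _)
  · calc ((1 : ℝ) / 2) ^ M * (|x - α| / rho n α) ^ μ α
        ≤ (1 / 2) ^ μ α * (|x - α| / rho n α) ^ μ α := by
          gcongr ?_ * _
          exact pow_le_pow_of_le_one (by norm_num) (by norm_num) (hμ α hα)
      _ ≤ _ := by
          rw [← mul_pow]
          gcongr
          rw [div_mul_div_comm, one_mul]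
          gcongr
          · exact offset_pos hn α x
          · unfold offset; linarith
  · refine pow_le_damping_of_far hn hs hμ (Finset.erase_subset α S) fun β hβ => ?_
    have h1 := hS6 α hα β (Finset.mem_of_mem_erase hβ) (Finset.ne_of_mem_erase hβ).symm
    have h2 := rho_le hn α
    have h3 := rho_le hn β
    have h4 := abs_sub_le α x β
    have e : (6 : ℝ) / n = 3 * (2 / n) := by ring
    rw [abs_sub_comm α x] at h4
    linarith

end

lemma slowly_varying_div_prod {n s M E : ℕ} (hn : 1 ≤ n) {S : Finset ℝ} (hs : S.card ≤ s)
    (hS : ∀ α ∈ S, α ∈ Set.Icc (-1 : ℝ) 1) {μ : ℝ → ℕ} (hμ : ∀ α ∈ S, μ α ≤ M) {B : ℝ} {Ψ : ℝ → ℝ}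
    (hΨ : ∀ x ∈ Set.Icc (-1 : ℝ) 1, 0 ≤ Ψ x)
    (hΨs : ∀ x ∈ Set.Icc (-1 : ℝ) 1, ∀ y ∈ Set.Icc (-1 : ℝ) 1, Ψ x ≤ B * angDist n x y ^ E * Ψ y)
    {x y : ℝ} (hx : x ∈ Set.Icc (-1 : ℝ) 1) (hy : y ∈ Set.Icc (-1 : ℝ) 1) :
    Ψ x / ∏ α ∈ S, offset n α x ^ μ α ≤ B * 5 ^ (M * s) * angDist n x y ^ (E + 2 * (M * s)) *
      (Ψ y / ∏ α ∈ S, offset n α y ^ μ α) := by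
  have hd := one_le_angDist n x y
  have hd2 : 1 ≤ 5 * angDist n x y ^ 2 := by nlinarith
  have hpx : 0 < ∏ α ∈ S, offset n α x ^ μ α :=
    Finset.prod_pos fun α _ => pow_pos (offset_pos hn α x) _
  have hpy : 0 < ∏ α ∈ S, offset n α y ^ μ α :=
    Finset.prod_pos fun α _ => pow_pos (offset_pos hn α y) _
  have h1 : ∏ α ∈ S, offset n α y ^ μ α ≤
      (5 * angDist n x y ^ 2) ^ (M * s) * ∏ α ∈ S, offset n α x ^ μ α := by
    calc _ ≤ ∏ α ∈ S, ((5 * angDist n x y ^ 2) ^ M * offset n α x ^ μ α) := by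
          refine Finset.prod_le_prod (fun α _ => (pow_pos (offset_pos hn α y) _).le) fun α hα => ?_
          have := offset_pos hn α x
          have := offset_pos hn α y
          calc offset n α y ^ μ α ≤ (5 * angDist n x y ^ 2 * offset n α x) ^ μ α := by
                gcongr; exact offset_le hn hx hy (hS α hα)
            _ = (5 * angDist n x y ^ 2) ^ μ α * offset n α x ^ μ α := mul_pow _ _ _
            _ ≤ _ := by gcongr; exact hμ α hα
      _ = (5 * angDist n x y ^ 2) ^ (M * S.card) * ∏ α ∈ S, offset n α x ^ μ α := by
          rw [Finset.prod_mul_distrib, Finset.prod_const, pow_mul]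
      _ ≤ _ := by gcongr
  have h2 := hΨs x hx y hy
  have h3 := hΨ x hx
  rw [mul_div_assoc', div_le_div_iff₀ hpx hpy]
  calc _ ≤ Ψ x * ((5 * angDist n x y ^ 2) ^ (M * s) * ∏ α ∈ S, offset n α x ^ μ α) := by gcongr
    _ ≤ B * angDist n x y ^ E * Ψ y *
        ((5 * angDist n x y ^ 2) ^ (M * s) * ∏ α ∈ S, offset n α x ^ μ α) := by gcongr
    _ = _ := by rw [mul_pow, ← pow_mul, pow_add]; ring

/-- A polynomial comparable to `Ψ` times the damping factors, vanishing to order `μ α` at `α`. -/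
theorem exists_vanishing_majorant (E s M : ℕ) (B : ℝ) (hB : 0 < B) :
    ∃ (K c : ℝ) (D : ℕ), 0 < K ∧ 0 < c ∧ ∀ n : ℕ, 1 ≤ n → ∀ S : Finset ℝ, S.card ≤ s →
    (∀ α ∈ S, α ∈ Set.Icc (-1 : ℝ) 1) → ∀ (μ : ℝ → ℕ) (σ : ℝ → ℝ), (∀ α ∈ S, μ α ≤ M) →
    (∀ α ∈ S, ∀ x ∈ Set.Icc (-1 : ℝ) 1, σ α * (x - α) ^ μ α = |x - α| ^ μ α) →
    ∀ Ψ : ℝ → ℝ, (∀ x ∈ Set.Icc (-1 : ℝ) 1, 0 ≤ Ψ x) →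
    (∀ x ∈ Set.Icc (-1 : ℝ) 1, ∀ y ∈ Set.Icc (-1 : ℝ) 1, Ψ x ≤ B * angDist n x y ^ E * Ψ y) →
    ∃ R : ℝ[X], R.natDegree ≤ D * n ∧ (∀ α ∈ S, (X - C α) ^ μ α ∣ R) ∧
      ∀ x ∈ Set.Icc (-1 : ℝ) 1, c * (Ψ x * damping n S μ x) ≤ R.eval x ∧ R.eval x ≤ K * Ψ x := by
  obtain ⟨K, c, hK, hc, H⟩ := exists_poly_equiv (E + 2 * (M * s)) (B * 5 ^ (M * s)) (by positivity)
  refine ⟨K, c, (E + 2 * (M * s) + 1) + M * s, hK, hc, fun n hn S hs hS μ σ hμ hσ Ψ hΨ hΨs => ?_⟩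
  obtain ⟨V, hVd, hV⟩ := H n hn (fun x => Ψ x / ∏ α ∈ S, offset n α x ^ μ α)
    (fun x hx => div_nonneg (hΨ x hx)
      (Finset.prod_nonneg fun α _ => pow_nonneg (offset_pos hn α x).le _))
    (fun x hx y hy => slowly_varying_div_prod hn hs hS hμ hΨ hΨs hx hy)
  refine ⟨V * ∏ α ∈ S, (C (σ α) * (X - C α) ^ μ α), ?_, fun α hα => ?_, fun x hx => ?_⟩
  · refine natDegree_mul_le.trans ?_
    rw [add_mul]
    refine add_le_add hVd ((natDegree_prod_le _ _).trans ?_)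
    calc _ ≤ ∑ α ∈ S, M := Finset.sum_le_sum fun α hα => (natDegree_C_mul_le _ _).trans <|
          (natDegree_pow_le_of_le _ (natDegree_X_sub_C_le α)).trans (by simpa using hμ α hα)
      _ = S.card * M := by rw [Finset.sum_const, smul_eq_mul]
      _ ≤ M * s := by rw [mul_comm]; gcongr
      _ ≤ M * s * n := Nat.le_mul_of_pos_right _ hn
  · exact Dvd.dvd.mul_left ((Dvd.intro_left _ rfl).trans
      (Finset.dvd_prod_of_mem (fun α => C (σ α) * (X - C α) ^ μ α) hα)) _
  · have e : (V * ∏ α ∈ S, (C (σ α) * (X - C α) ^ μ α)).eval x =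
        V.eval x * ∏ α ∈ S, |x - α| ^ μ α := by
      simp only [eval_mul, eval_prod, eval_C, eval_pow, eval_sub, eval_X]
      congr 1
      exact Finset.prod_congr rfl fun α hα => hσ α hα x hx
    have e2 : Ψ x * damping n S μ x =
        (Ψ x / ∏ α ∈ S, offset n α x ^ μ α) * ∏ α ∈ S, |x - α| ^ μ α := by
      unfold damping
      simp only [div_pow, Finset.prod_div_distrib]; ring
    have hp : 0 ≤ ∏ α ∈ S, |x - α| ^ μ α := Finset.prod_nonneg fun α _ => by positivity
    obtain ⟨h1, h2⟩ := hV x hx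
    rw [e]
    constructor
    · rw [e2, ← mul_assoc]; gcongr
    · calc _ ≤ K * (Ψ x / ∏ α ∈ S, offset n α x ^ μ α) * ∏ α ∈ S, |x - α| ^ μ α := by gcongr
        _ = K * (Ψ x * damping n S μ x) := by rw [e2, ← mul_assoc]
        _ ≤ K * (Ψ x * 1) := by
            have := hΨ x hx
            gcongr; exact damping_le_one hn x
        _ = _ := by ring

/-- `P` corrects `Q` towards the prescribed local polynomials `q α`, `α ∈ S`. -/
theorem exists_interpolating_correction (E L s M : ℕ) (B : ℝ) (hB : 0 < B) (hM : 1 ≤ M) :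
    ∃ (K : ℝ) (D : ℕ), 0 < K ∧ ∀ n : ℕ, 1 ≤ n → ∀ S : Finset ℝ, S.card ≤ s →
    (∀ α ∈ S, α ∈ Set.Icc (-1 : ℝ) 1) → (∀ α ∈ S, ∀ β ∈ S, α ≠ β → 6 / (n : ℝ) ≤ |α - β|) →
    ∀ (f Ψ : ℝ → ℝ) (q : ℝ → ℝ[X]), (∀ x ∈ Set.Icc (-1 : ℝ) 1, 0 ≤ Ψ x) →
    (∀ x ∈ Set.Icc (-1 : ℝ) 1, ∀ y ∈ Set.Icc (-1 : ℝ) 1, Ψ x ≤ B * angDist n x y ^ E * Ψ y) →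
    (∀ y ∈ Set.Icc (-1 : ℝ) 1, (q y).natDegree ≤ L) →
    (∀ x ∈ Set.Icc (-1 : ℝ) 1, ∀ y ∈ Set.Icc (-1 : ℝ) 1,
      |f x - (q y).eval x| ≤ B * Ψ y * angDist n x y ^ E) →
    ∃ P : ℝ[X], P.natDegree ≤ D * n ∧ (∀ α ∈ S, (X - C α) ^ M ∣ P - q α) ∧
      (∀ x ∈ Set.Icc (-1 : ℝ) 1, |f x - P.eval x| ≤ K * Ψ x) ∧
      ∀ α ∈ S, ∀ x ∈ Set.Icc (-1 : ℝ) 1, |x - α| ≤ rho n α →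
        |P.eval x - (q α).eval x| ≤ K * Ψ x * (|x - α| / rho n α) ^ M := by
  obtain ⟨C₁, hC₁, H₁⟩ := exists_poly_approx E L B hB
  obtain ⟨K₁, D₁, hK₁, H₂⟩ := exists_hermite_peak s (2 * E) M hM
  set G := B ^ 2 + C₁ with hG
  have hG0 : 0 < G := by positivity
  refine ⟨C₁ + s * (K₁ * G) + K₁ * G * 11 ^ (2 * E), D₁ + (E + 1) + L, by positivity,
    fun n hn S hs hS hsep f Ψ q hΨ hΨs hq hfq => ?_⟩
  have hn0 : (0 : ℝ) < n := by exact_mod_cast hn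
  obtain ⟨Q, hQd, hQ⟩ := H₁ n hn f Ψ q hΨ hΨs hq hfq
  obtain ⟨Λ, hΛ⟩ := H₂ n hn S hs hS fun α hα β hβ h =>
    le_trans (by gcongr; norm_num) (hsep α hα β hβ h)
  have hqQ : ∀ α ∈ S, ∀ x ∈ Set.Icc (-1 : ℝ) 1,
      |(q α).eval x - Q.eval x| ≤ G * Ψ x * angDist n x α ^ (2 * E) := by
    intro α hα x hx
    have h1 := hfq x hx α (hS α hα)
    have h2 := hΨs α (hS α hα) x hx
    have h3 := hQ x hx
    rw [angDist_comm n α x] at h2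
    have hd := angDist_pos n x α
    have hd1 : 1 ≤ angDist n x α ^ (2 * E) := one_le_pow₀ (one_le_angDist n x α)
    have hΨx := hΨ x hx
    calc _ = |(f x - Q.eval x) - (f x - (q α).eval x)| := by congr 1; ring
      _ ≤ |f x - Q.eval x| + |f x - (q α).eval x| := abs_sub _ _
      _ ≤ C₁ * Ψ x * 1 + B * (B * angDist n x α ^ E * Ψ x) * angDist n x α ^ E := by
          rw [mul_one]
          refine add_le_add h3 (h1.trans ?_)
          gcongr
      _ ≤ C₁ * Ψ x * angDist n x α ^ (2 * E) +
          B * (B * angDist n x α ^ E * Ψ x) * angDist n x α ^ E := by gcongr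
      _ = _ := by rw [hG]; ring
  have hterm : ∀ α ∈ S, ∀ x ∈ Set.Icc (-1 : ℝ) 1, ∀ u : ℝ,
      |(Λ α).eval x| * angDist n x α ^ (2 * E) ≤ u →
      |(Λ α).eval x * ((q α).eval x - Q.eval x)| ≤ u * G * Ψ x := by
    intro α hα x hx u hu
    have hΨx := hΨ x hx
    rw [abs_mul]
    calc _ ≤ |(Λ α).eval x| * (G * Ψ x * angDist n x α ^ (2 * E)) := by
          gcongr; exact hqQ α hα x hx
      _ = (|(Λ α).eval x| * angDist n x α ^ (2 * E)) * (G * Ψ x) := by ring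
      _ ≤ u * (G * Ψ x) := by gcongr
      _ = _ := by ring
  have hsplit : ∀ α ∈ S, Q + ∑ β ∈ S, Λ β * (q β - Q) - q α =
      (1 - Λ α) * (Q - q α) + ∑ β ∈ S.erase α, Λ β * (q β - Q) := by
    intro α hα
    rw [← Finset.add_sum_erase _ _ hα]; ring
  refine ⟨Q + ∑ β ∈ S, Λ β * (q β - Q), ?_, fun α hα => ?_, fun x hx => ?_, fun α hα x hx hnear => ?_⟩
  · have hL : L ≤ L * n := Nat.le_mul_of_pos_right _ hn
    refine (natDegree_add_le _ _).trans (max_le ?_ ?_)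
    · refine hQd.trans ?_
      rw [add_mul _ L, add_mul D₁]; omega
    · refine natDegree_sum_le_of_forall_le _ _ fun β hβ => natDegree_mul_le.trans ?_
      have h1 := (hΛ β hβ).1
      have h2 : (q β - Q).natDegree ≤ (E + 1) * n + L :=
        (natDegree_sub_le _ _).trans (max_le ((hq β (hS β hβ)).trans (by omega)) hQd)
      rw [add_mul _ L, add_mul D₁]; omega
  · rw [hsplit α hα]
    refine dvd_add ((hΛ α hα).2.1.mul_right _) (Finset.dvd_sum fun β hβ => ?_)
    exact ((hΛ β (Finset.mem_of_mem_erase hβ)).2.2.1 α hα (Finset.ne_of_mem_erase hβ).symm).mul_right _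
  · have hΨx := hΨ x hx
    have e : f x - (Q + ∑ β ∈ S, Λ β * (q β - Q)).eval x =
        (f x - Q.eval x) - ∑ β ∈ S, (Λ β).eval x * ((q β).eval x - Q.eval x) := by
      simp only [eval_add, eval_finsetSum, eval_mul, eval_sub]; ring
    rw [e]
    have h1 : |∑ β ∈ S, (Λ β).eval x * ((q β).eval x - Q.eval x)| ≤ s * (K₁ * G * Ψ x) := by
      refine (Finset.abs_sum_le_sum_abs _ _).trans ?_
      calc _ ≤ ∑ β ∈ S, K₁ * G * Ψ x := Finset.sum_le_sum fun β hβ =>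
            hterm β hβ x hx K₁ ((hΛ β hβ).2.2.2.1 x hx)
        _ = S.card * (K₁ * G * Ψ x) := by rw [Finset.sum_const, nsmul_eq_mul]
        _ ≤ _ := by gcongr
    have h2 := hQ x hx
    have h3 := abs_sub (f x - Q.eval x) (∑ β ∈ S, (Λ β).eval x * ((q β).eval x - Q.eval x))
    have h4 : 0 ≤ K₁ * G * 11 ^ (2 * E) * Ψ x := by positivity
    linarith
  · have hΨx := hΨ x hx
    have hr := rho_pos hn α
    set t := |x - α| / rho n α
    have ht : 0 ≤ t ^ M := by positivity
    have e : (Q + ∑ β ∈ S, Λ β * (q β - Q)).eval x - (q α).eval x =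
        (1 - (Λ α).eval x) * (Q.eval x - (q α).eval x) +
          ∑ β ∈ S.erase α, (Λ β).eval x * ((q β).eval x - Q.eval x) := by
      rw [← eval_sub, hsplit α hα]
      simp only [eval_add, eval_finsetSum, eval_mul, eval_sub, eval_one]
    rw [e]
    have h1 : |∑ β ∈ S.erase α, (Λ β).eval x * ((q β).eval x - Q.eval x)| ≤
        s * (K₁ * t ^ M * G * Ψ x) := by
      refine (Finset.abs_sum_le_sum_abs _ _).trans ?_
      calc _ ≤ ∑ β ∈ S.erase α, K₁ * t ^ M * G * Ψ x := Finset.sum_le_sum fun β hβ =>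
            hterm β (Finset.mem_of_mem_erase hβ) x hx _
              ((hΛ β (Finset.mem_of_mem_erase hβ)).2.2.2.2.2 α hα (Finset.ne_of_mem_erase hβ).symm x hx)
        _ = (S.erase α).card * (K₁ * t ^ M * G * Ψ x) := by rw [Finset.sum_const, nsmul_eq_mul]
        _ ≤ _ := by
          gcongr
          exact Finset.card_erase_le.trans hs
    have h2 : |(1 - (Λ α).eval x) * (Q.eval x - (q α).eval x)| ≤
        K₁ * t ^ M * (G * Ψ x * 11 ^ (2 * E)) := by
      rw [abs_mul]
      have ha := (hΛ α hα).2.2.2.2.1 x hx hnear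
      have hb := hqQ α hα x hx
      rw [abs_sub_comm] at hb
      have hd := angDist_le_of_abs_sub_le hn hx (hS α hα) hnear
      have hd0 := angDist_pos n x α
      gcongr
      refine hb.trans ?_
      gcongr
    have h3 := abs_add_le ((1 - (Λ α).eval x) * (Q.eval x - (q α).eval x))
      (∑ β ∈ S.erase α, (Λ β).eval x * ((q β).eval x - Q.eval x))
    have h4 : 0 ≤ C₁ * Ψ x * t ^ M := by positivity
    calc _ ≤ _ := h3
      _ ≤ K₁ * t ^ M * (G * Ψ x * 11 ^ (2 * E)) + s * (K₁ * t ^ M * G * Ψ x) := add_le_add h2 h1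
      _ ≤ _ := by linarith

theorem exists_nonneg_interpolant (E L s M : ℕ) (B : ℝ) (hB : 0 < B) :
    ∃ (K : ℝ) (D : ℕ), 0 < K ∧ ∀ n : ℕ, 1 ≤ n → ∀ S : Finset ℝ, S.card ≤ s →
    (∀ α ∈ S, α ∈ Set.Icc (-1 : ℝ) 1) → (∀ α ∈ S, ∀ β ∈ S, α ≠ β → 6 / (n : ℝ) ≤ |α - β|) →
    ∀ (f Ψ : ℝ → ℝ) (q : ℝ → ℝ[X]) (μ : ℝ → ℕ) (σ : ℝ → ℝ),
    (∀ x ∈ Set.Icc (-1 : ℝ) 1, 0 ≤ f x) → (∀ x ∈ Set.Icc (-1 : ℝ) 1, 0 ≤ Ψ x) →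
    (∀ x ∈ Set.Icc (-1 : ℝ) 1, ∀ y ∈ Set.Icc (-1 : ℝ) 1, Ψ x ≤ B * angDist n x y ^ E * Ψ y) →
    (∀ y ∈ Set.Icc (-1 : ℝ) 1, (q y).natDegree ≤ L) →
    (∀ x ∈ Set.Icc (-1 : ℝ) 1, ∀ y ∈ Set.Icc (-1 : ℝ) 1,
      |f x - (q y).eval x| ≤ B * Ψ y * angDist n x y ^ E) →
    (∀ α ∈ S, μ α ≤ M) →
    (∀ α ∈ S, ∀ x ∈ Set.Icc (-1 : ℝ) 1, σ α * (x - α) ^ μ α = |x - α| ^ μ α) →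
    (∀ α ∈ S, ∀ x ∈ Set.Icc (-1 : ℝ) 1, |x - α| ≤ rho n α →
      -(B * Ψ α * (|x - α| / rho n α) ^ μ α) ≤ (q α).eval x) →
    ∃ P : ℝ[X], P.natDegree ≤ D * n ∧ (∀ x ∈ Set.Icc (-1 : ℝ) 1, 0 ≤ P.eval x) ∧
      (∀ α ∈ S, (X - C α) ^ μ α ∣ P - q α) ∧
      ∀ x ∈ Set.Icc (-1 : ℝ) 1, |f x - P.eval x| ≤ K * Ψ x := by
  obtain ⟨K₁, D₁, hK₁, H₁⟩ := exists_interpolating_correction E L s (M + 1) B hB (by omega)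
  obtain ⟨K₂, c, D₂, hK₂, hc, H₂⟩ := exists_vanishing_majorant E s M B hB
  set G := K₁ + B ^ 2 * 11 ^ E with hG
  have hG0 : 0 < G := by positivity
  set η : ℝ := (1 / 2) ^ (M * s) * (1 / 2) ^ M with hη
  have hη0 : 0 < η := by positivity
  set A := G / (η * c) with hA
  have hA0 : 0 < A := by positivity
  refine ⟨K₁ + A * K₂, D₁ + D₂, by positivity,
    fun n hn S hs hS hsep f Ψ q μ σ hf hΨ hΨs hq hfq hμ hσ hlow => ?_⟩
  obtain ⟨Q, hQd, hQdvd, hQ, hQnear⟩ := H₁ n hn S hs hS hsep f Ψ q hΨ hΨs hq hfq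
  obtain ⟨R, hRd, hRdvd, hR⟩ := H₂ n hn S hs hS μ σ hμ hσ Ψ hΨ hΨs
  have hQlow : ∀ x ∈ Set.Icc (-1 : ℝ) 1, -(G / η * (Ψ x * damping n S μ x)) ≤ Q.eval x := by
    intro x hx
    have hΨx := hΨ x hx
    by_cases hz : ∃ α ∈ S, |x - α| ≤ rho n α
    · obtain ⟨α, hα, hxα⟩ := hz
      have hr := rho_pos hn α
      have hdamp := pow_le_damping_of_near hn hs hμ hsep hα hxα
      have h1 := hQnear α hα x hx hxα
      have h2 := hlow α hα x hx hxα
      have h3 := hΨs α (hS α hα) x hx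
      have hd := angDist_le_of_abs_sub_le hn hx (hS α hα) hxα
      rw [angDist_comm] at h3
      have hd0 := angDist_pos n x α
      set t := |x - α| / rho n α
      have ht : 0 ≤ t := by positivity
      have ht1 : t ≤ 1 := (div_le_one hr).2 hxα
      have h4 : Ψ α ≤ B * 11 ^ E * Ψ x := h3.trans (by gcongr)
      have h5 : K₁ * Ψ x * t ^ (M + 1) ≤ K₁ * Ψ x * t ^ μ α := by
        gcongr ?_ * ?_
        exact pow_le_pow_of_le_one ht ht1 ((hμ α hα).trans (by omega))
      have h6 : B * Ψ α * t ^ μ α ≤ B * (B * 11 ^ E * Ψ x) * t ^ μ α := by gcongr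
      have h7 := (abs_le.1 h1).1
      have h8 : G * Ψ x * t ^ μ α ≤ G / η * (Ψ x * damping n S μ x) := by
        rw [div_mul_eq_mul_div, le_div_iff₀ hη0]
        calc _ = G * Ψ x * (η * t ^ μ α) := by ring
          _ ≤ G * Ψ x * damping n S μ x := by gcongr
          _ = _ := by ring
      have h9 : G * Ψ x * t ^ μ α = K₁ * Ψ x * t ^ μ α + B * (B * 11 ^ E * Ψ x) * t ^ μ α := by
        rw [hG]; ring
      linarith
    · push Not at hz
      have hdamp := pow_le_damping_of_far hn hs hμ subset_rfl fun α hα => (hz α hα).le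
      have h1 := (abs_le.1 (hQ x hx)).2
      have h2 := hf x hx
      have h3 : η ≤ damping n S μ x :=
        le_trans (mul_le_of_le_one_right (by positivity) (pow_le_one₀ (by norm_num) (by norm_num))) hdamp
      have h4 : G * Ψ x ≤ G / η * (Ψ x * damping n S μ x) := by
        rw [div_mul_eq_mul_div, le_div_iff₀ hη0]
        calc _ ≤ G * Ψ x * damping n S μ x := by gcongr
          _ = _ := by ring
      have h5 : K₁ * Ψ x ≤ G * Ψ x := by
        gcongr; rw [hG]; linarith [show 0 < B ^ 2 * 11 ^ E by positivity]
      linarith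
  refine ⟨Q + C A * R, ?_, fun x hx => ?_, fun α hα => ?_, fun x hx => ?_⟩
  · rw [add_mul]
    refine (natDegree_add_le _ _).trans (max_le (by omega) ?_)
    exact ((natDegree_C_mul_le _ _).trans hRd).trans (by omega)
  · have h1 := hQlow x hx
    have h2 := mul_le_mul_of_nonneg_left (hR x hx).1 hA0.le
    rw [eval_add, eval_mul, eval_C]
    have e : A * (c * (Ψ x * damping n S μ x)) = G / η * (Ψ x * damping n S μ x) := by
      rw [hA]; field_simp
    linarith
  · rw [add_sub_right_comm]
    refine dvd_add ((pow_dvd_pow _ ((hμ α hα).trans (by omega))).trans (hQdvd α hα)) ?_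
    exact (hRdvd α hα).mul_left _
  · rw [eval_add, eval_mul, eval_C]
    have h1 := abs_le.1 (hQ x hx)
    have h2 := mul_le_mul_of_nonneg_left (hR x hx).1 hA0.le
    have h3 := mul_le_mul_of_nonneg_left (hR x hx).2 hA0.le
    have h4 : 0 ≤ A * (c * (Ψ x * damping n S μ x)) := by
      have := hΨ x hx
      have := damping_nonneg hn (S := S) (μ := μ) x
      positivity
    have h5 : 0 ≤ A * K₂ * Ψ x := by have := hΨ x hx; positivity
    rw [abs_le]; constructor <;> linarith

section Modulus

variable {g : ℝ → ℝ} {k : ℕ} {t : ℝ}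

lemma fwdDiff_iter_eq_sum (h : ℝ) (g : ℝ → ℝ) (k : ℕ) (x : ℝ) : (fwdDiff h)^[k] g x =
    ∑ i ∈ Finset.range (k + 1), (-1 : ℝ) ^ (k - i) * (k.choose i : ℝ) * g (x + (i : ℝ) * h) := by
  rw [fwdDiff_iter_eq_sum_shift]
  simp

lemma omegaK_nonneg (g : ℝ → ℝ) (k : ℕ) (t a b : ℝ) : 0 ≤ omegaK g k t a b := by
  apply Real.sSup_nonneg
  rintro v ⟨h, x, -, -, -, -, rfl⟩
  exact abs_nonneg _

lemma omegaK_le {A : ℝ} (hA : 0 ≤ A) (H : ∀ h x : ℝ, 0 < h → h ≤ t → -1 ≤ x → x + k * h ≤ 1 →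
    |(fwdDiff h)^[k] g x| ≤ A) : omegaK g k t (-1) 1 ≤ A := by
  refine Real.sSup_le ?_ hA
  rintro v ⟨h, x, h0, ht, hx, hx1, rfl⟩
  rw [← fwdDiff_iter_eq_sum]
  exact H h x h0 ht hx hx1

lemma abs_fwdDiff_le_omegaK (hg : ContinuousOn g (Set.Icc (-1) 1)) {h x : ℝ} (h0 : 0 < h)
    (ht : h ≤ t) (hx : -1 ≤ x) (hx1 : x + k * h ≤ 1) :
    |(fwdDiff h)^[k] g x| ≤ omegaK g k t (-1) 1 := by
  obtain ⟨M, hM⟩ := isCompact_Icc.exists_bound_of_continuousOn hg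
  rw [fwdDiff_iter_eq_sum]
  refine le_csSup ⟨∑ i ∈ Finset.range (k + 1), (k.choose i : ℝ) * M, ?_⟩
    ⟨h, x, h0, ht, hx, hx1, rfl⟩
  rintro v ⟨h, x, h0, ht, hx, hx1, rfl⟩
  refine (Finset.abs_sum_le_sum_abs _ _).trans (Finset.sum_le_sum fun i hi => ?_)
  rw [abs_mul, abs_mul, abs_pow, abs_neg, abs_one, one_pow, one_mul, Nat.abs_cast]
  have hi' : (i : ℝ) ≤ k := by exact_mod_cast Nat.lt_succ_iff.1 (Finset.mem_range.1 hi)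
  gcongr
  exact hM _ ⟨by have := mul_nonneg (Nat.cast_nonneg (α := ℝ) i) h0.le; linarith, by nlinarith⟩

lemma fwdDiff_nat_mul (h : ℝ) (g : ℝ → ℝ) (m : ℕ) :
    fwdDiff (m * h) g = ∑ i ∈ Finset.range m, fun x => fwdDiff h g (x + i * h) := by
  ext x
  rw [Finset.sum_apply]
  have := Finset.sum_range_sub (fun i : ℕ => g (x + i * h)) m
  simp only [Nat.cast_zero, zero_mul, add_zero] at this
  rw [fwdDiff, ← this]
  refine Finset.sum_congr rfl fun i _ => ?_
  simp only [fwdDiff]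
  push_cast
  ring_nf

lemma abs_fwdDiff_nat_mul_le {h A : ℝ} (hh : 0 ≤ h) {m : ℕ} (hm : 1 ≤ m) (k : ℕ) : ∀ (g : ℝ → ℝ)
    (x : ℝ), (∀ y, x ≤ y → y ≤ x + k * ((m - 1) * h) → |(fwdDiff h)^[k] g y| ≤ A) →
    |(fwdDiff (m * h))^[k] g x| ≤ m ^ k * A := by
  have hm' : (1 : ℝ) ≤ m := by exact_mod_cast hm
  induction k with
  | zero =>
    intro g x H
    simpa using H x le_rfl (by simp)
  | succ k ih =>
    intro g x H
    rw [Function.iterate_succ_apply, fwdDiff_nat_mul, fwdDiff_iter_finsetSum, Finset.sum_apply]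
    refine (Finset.abs_sum_le_sum_abs _ _).trans ?_
    have : ∀ i ∈ Finset.range m,
        |(fwdDiff (m * h))^[k] (fun x => fwdDiff h g (x + i * h)) x| ≤ m ^ k * A := by
      intro i hi
      rw [fwdDiff_iter_comp_add]
      have hi' : (i : ℝ) + 1 ≤ m := by exact_mod_cast Finset.mem_range.1 hi
      have hi0 : 0 ≤ (i : ℝ) * h := by positivity
      refine ih _ _ fun y hy hy1 => ?_
      rw [← Function.iterate_succ_apply]
      refine H y (by linarith) ?_
      push_cast
      nlinarith
    refine (Finset.sum_le_sum this).trans (le_of_eq ?_)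
    rw [Finset.sum_const, Finset.card_range, nsmul_eq_mul]
    ring

lemma omegaK_le_mul (hg : ContinuousOn g (Set.Icc (-1) 1)) {t' c : ℝ} (hc : 1 ≤ c)
    (ht : t' ≤ c * t) : omegaK g k t' (-1) 1 ≤ (2 * c) ^ k * omegaK g k t (-1) 1 := by
  have h0 := omegaK_nonneg g k t (-1) 1
  refine omegaK_le (by positivity) fun h x hh hht hx hx1 => ?_
  have hm : 1 ≤ ⌈c⌉₊ := Nat.one_le_ceil_iff.2 (by linarith)
  have hm' : (1 : ℝ) ≤ ⌈c⌉₊ := by exact_mod_cast hm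
  have hm2 : (⌈c⌉₊ : ℝ) ≤ 2 * c := by linarith [Nat.ceil_lt_add_one (by linarith : 0 ≤ c)]
  have hcm := Nat.le_ceil c
  set m := ⌈c⌉₊
  have e : h = m * (h / m) := by field_simp
  have hhm : h / m ≤ t := by
    have htp : 0 < t := by
      by_contra! hcon
      nlinarith
    rw [div_le_iff₀ (by linarith)]
    nlinarith
  have := abs_fwdDiff_nat_mul_le (h := h / m) (A := omegaK g k t (-1) 1) (by positivity) hm k g x
    fun y hy hy1 => abs_fwdDiff_le_omegaK hg (by positivity) hhm (by linarith) (by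
      have : (k : ℝ) * ((m - 1) * (h / m)) + k * (h / m) = k * h := by field_simp; ring
      linarith)
  rw [← e] at this
  exact this.trans (by gcongr)

end Modulus

section Taylor

/-- A polynomial with prescribed derivative and prescribed value at `y`. -/
lemma exists_antiderivative (s : ℝ[X]) (y c : ℝ) : ∃ q : ℝ[X],
    derivative q = s ∧ q.eval y = c := by
  let S : ℝ[X] := ∑ i ∈ Finset.range (s.natDegree + 1), C (s.coeff i / (i + 1)) * X ^ (i + 1)
  have hS : derivative S = s := by
    conv_rhs => rw [s.as_sum_range_C_mul_X_pow]
    rw [derivative_sum]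
    refine Finset.sum_congr rfl fun i _ => ?_
    rw [derivative_C_mul_X_pow]
    congr 2
    push_cast
    field_simp
  exact ⟨S + C (c - S.eval y), by simp [hS], by simp⟩

lemma degree_lt_succ_of_derivative {q : ℝ[X]} {m : ℕ} (h : (derivative q).degree < m) :
    q.degree < (m + 1 : ℕ) := by
  rw [degree_lt_iff_coeff_zero] at h ⊢
  rintro (_ | i) hi
  · omega
  · have := h i (by omega)
    rw [coeff_derivative] at this
    exact (mul_eq_zero.1 this).resolve_right (by positivity)

/-- Integrating a local approximation of the top derivative in a chain of derivatives. -/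
lemma exists_taylor {y : ℝ} (hy : y ∈ Set.Icc (-1 : ℝ) 1) {s : ℝ[X]} {b : ℝ → ℝ}
    (hb : ∀ u v, 0 ≤ u → u ≤ v → b u ≤ b v) {m : ℕ} (hs : s.degree < m) (r : ℕ) : ∀ F : ℕ → ℝ → ℝ,
    (∀ l < r, ∀ x ∈ Set.Icc (-1 : ℝ) 1,
      HasDerivWithinAt (F l) (F (l + 1) x) (Set.Icc (-1) 1) x) →
    (∀ x ∈ Set.Icc (-1 : ℝ) 1, |F r x - s.eval x| ≤ b |x - y|) →
    ∃ q : ℝ[X], q.degree < (m + r : ℕ) ∧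
      (∀ i < r, (derivative^[i] q).eval y = F i y) ∧
      ∀ x ∈ Set.Icc (-1 : ℝ) 1, |F 0 x - q.eval x| ≤ |x - y| ^ r * b |x - y| := by
  induction r with
  | zero =>
    intro F _ h
    exact ⟨s, hs, by simp, by simpa using h⟩
  | succ r ih =>
    intro F hF h
    obtain ⟨q, hqd, hqi, hqe⟩ := ih (fun l => F (l + 1)) (fun l hl => hF (l + 1) (by omega)) h
    obtain ⟨Q, hQ, hQy⟩ := exists_antiderivative q y (F 0 y)
    refine ⟨Q, degree_lt_succ_of_derivative (hQ ▸ hqd), ?_, fun x hx => ?_⟩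
    · rintro (_ | i) hi
      · simpa using hQy
      · rw [Function.iterate_succ_apply, hQ]
        exact hqi i (by omega)
    · have hsub : Set.uIcc y x ⊆ Set.Icc (-1 : ℝ) 1 :=
        Set.uIcc_subset_Icc hy hx
      have hder : ∀ z ∈ Set.uIcc y x, HasDerivWithinAt (fun z => F 0 z - Q.eval z)
          (F 1 z - q.eval z) (Set.uIcc y x) z := by
        intro z hz
        have h1 := (hF 0 (by omega) z (hsub hz)).mono hsub
        have h2 := (Q.hasDerivAt z).hasDerivWithinAt (s := Set.uIcc y x)
        rw [hQ] at h2
        exact h1.sub h2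
      have hbd : ∀ z ∈ Set.uIcc y x, ‖F 1 z - q.eval z‖ ≤ |x - y| ^ r * b |x - y| := by
        intro z hz
        have hzy : |z - y| ≤ |x - y| := Set.abs_sub_left_of_mem_uIcc hz
        have h1 := hqe z (hsub hz)
        refine h1.trans ?_
        have h2 : 0 ≤ b |z - y| := (abs_nonneg _).trans (h z (hsub hz))
        have h3 := hb _ _ (abs_nonneg _) hzy
        gcongr
      have := (convex_uIcc y x).norm_image_sub_le_of_norm_hasDerivWithin_le hder hbd
        Set.left_mem_uIcc Set.right_mem_uIcc
      simp only [hQy, sub_self, sub_zero, Real.norm_eq_abs] at this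
      rw [pow_succ]
      linarith

end Taylor

section Steklov

/-- The Steklov mean `∫₀¹ g (x + η u) du`. -/
noncomputable def steklov (η : ℝ) (g : ℝ → ℝ) (x : ℝ) : ℝ := ∫ u in (0 : ℝ)..1, g (x + η * u)

lemma steklov_continuous {η : ℝ} {g : ℝ → ℝ} (hg : Continuous g) : Continuous (steklov η g) := by
  unfold steklov
  fun_prop

lemma steklov_iterate_continuous {η : ℝ} {g : ℝ → ℝ} (hg : Continuous g) (m : ℕ) :
    Continuous ((steklov η)^[m] g) := by
  induction m with
  | zero => exact hg
  | succ m ih =>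
    rw [Function.iterate_succ_apply']
    exact steklov_continuous ih

lemma hasDerivAt_steklov {η : ℝ} (hη : η ≠ 0) {g : ℝ → ℝ} (hg : Continuous g) (x : ℝ) :
    HasDerivAt (steklov η g) (η⁻¹ * fwdDiff η g x) x := by
  have e : steklov η g = fun x => η⁻¹ * ((∫ u in (0 : ℝ)..(x + η), g u) - ∫ u in (0 : ℝ)..x, g u) := by
    ext x
    rw [steklov, intervalIntegral.integral_comp_add_mul _ hη,
      intervalIntegral.integral_interval_sub_left (hg.intervalIntegrable _ _)
        (hg.intervalIntegrable _ _)]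
    simp
  rw [e]
  have h1 := (hg.integral_hasStrictDerivAt 0 x).hasDerivAt
  have h2 := (hg.integral_hasStrictDerivAt 0 (x + η)).hasDerivAt.comp_add_const x η
  exact (h2.sub h1).const_mul _

lemma contDiff_steklov_iterate {η : ℝ} (hη : η ≠ 0) {g : ℝ → ℝ} (hg : Continuous g) (m : ℕ) :
    ContDiff ℝ m ((steklov η)^[m] g) ∧
      iteratedDeriv m ((steklov η)^[m] g) = (η⁻¹) ^ m • (fwdDiff η)^[m] g := by
  induction m with
  | zero => simpa using hg
  | succ m ih =>
    obtain ⟨ih1, ih2⟩ := ih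
    rw [Function.iterate_succ_apply']
    have hd := fun x => hasDerivAt_steklov hη (steklov_iterate_continuous (η := η) hg m) x
    have hd' : deriv (steklov η ((steklov η)^[m] g)) =
        fun x => η⁻¹ * ((steklov η)^[m] g (x + η) - (steklov η)^[m] g x) :=
      funext fun x => (hd x).deriv
    have h1 : ContDiff ℝ m fun x => (steklov η)^[m] g (x + η) := by fun_prop
    constructor
    · push_cast
      rw [contDiff_succ_iff_deriv]
      refine ⟨fun x => (hd x).differentiableAt, by simp, ?_⟩
      rw [hd']
      fun_prop
    · ext x
      rw [iteratedDeriv_succ', hd']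
      have h2 : ContDiff ℝ m fun x => ((steklov η)^[m] g (x + η) - (steklov η)^[m] g x) := by
        fun_prop
      rw [iteratedDeriv_const_mul _ h2.contDiffAt,
        iteratedDeriv_fun_sub h1.contDiffAt ih1.contDiffAt, iteratedDeriv_comp_add_const, ih2,
        Function.iterate_succ_apply']
      simp only [Pi.smul_apply, smul_eq_mul, fwdDiff]
      ring

lemma abs_sum_steklov_le {ι : Type*} (T : Finset ι) (c a η : ι → ℝ) {g : ℝ → ℝ}
    (hg : Continuous g) {W : ℝ} (m : ℕ) : ∀ s : ℝ,
    (∀ v, s ≤ v → v ≤ s + m → |∑ i ∈ T, c i * g (a i + η i * v)| ≤ W) →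
    |∑ i ∈ T, c i * (steklov (η i))^[m] g (a i + η i * s)| ≤ W := by
  induction m with
  | zero =>
    intro s H
    exact H s le_rfl (by simp)
  | succ m ih =>
    intro s H
    have e : ∑ i ∈ T, c i * (steklov (η i))^[m + 1] g (a i + η i * s) =
        ∫ u in (0 : ℝ)..1, ∑ i ∈ T, c i * (steklov (η i))^[m] g (a i + η i * (s + u)) := by
      have hc := fun i => steklov_iterate_continuous (η := η i) hg m
      rw [intervalIntegral.integral_finsetSum]
      · refine Finset.sum_congr rfl fun i _ => ?_
        rw [Function.iterate_succ_apply', steklov, intervalIntegral.integral_const_mul]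
        simp only [mul_add, add_assoc]
      · intro i _
        have := hc i
        apply Continuous.intervalIntegrable
        fun_prop
    rw [e, ← Real.norm_eq_abs]
    have := intervalIntegral.norm_integral_le_of_norm_le_const (a := 0) (b := 1) (C := W)
      (f := fun u => ∑ i ∈ T, c i * (steklov (η i))^[m] g (a i + η i * (s + u))) fun u hu => by
        rw [Set.uIoc_of_le zero_le_one] at hu
        refine ih (s + u) fun v hv hv1 => H v (by linarith [hu.1]) ?_
        push_cast
        linarith [hu.2]
    simpa using this

end Steklov

section Whitney

lemma fwdDiff_neg_iter (h : ℝ) (g : ℝ → ℝ) (k : ℕ) (x : ℝ) :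
    (fwdDiff (-h))^[k] g x = (-1) ^ k * (fwdDiff h)^[k] g (x - k * h) := by
  induction k generalizing g x with
  | zero => simp
  | succ k ih =>
    rw [Function.iterate_succ_apply', fwdDiff, ih, ih, Function.iterate_succ_apply', fwdDiff]
    push_cast
    ring_nf

lemma abs_fwdDiff_le_omegaK' {g : ℝ → ℝ} {k : ℕ} {t : ℝ} (hk : 1 ≤ k)
    (hg : ContinuousOn g (Set.Icc (-1) 1)) {h x : ℝ}
    (ht : |h| ≤ t) (hx : x ∈ Set.Icc (-1 : ℝ) 1) (hx1 : x + k * h ∈ Set.Icc (-1 : ℝ) 1) :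
    |(fwdDiff h)^[k] g x| ≤ omegaK g k t (-1) 1 := by
  rcases lt_trichotomy h 0 with h0 | rfl | h0
  · rw [← neg_neg h, fwdDiff_neg_iter, abs_mul, abs_pow, abs_neg, abs_one, one_pow, one_mul]
    refine abs_fwdDiff_le_omegaK hg (by linarith) ((neg_le_abs h).trans ht) ?_ ?_
    · linarith [hx1.1]
    · linarith [hx.2]
  · have : fwdDiff (0 : ℝ) g = fun _ => 0 := by ext; simp [fwdDiff]
    obtain ⟨k, rfl⟩ := Nat.exists_eq_add_of_le' hk
    rw [Function.iterate_succ_apply, this]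
    have h0 : ∀ k : ℕ, (fwdDiff (0 : ℝ))^[k] (fun _ => (0 : ℝ)) = fun _ => 0 := by
      intro k
      induction k with
      | zero => rfl
      | succ k ih => rw [Function.iterate_succ_apply', ih]; ext; simp [fwdDiff]
    rw [h0, abs_zero]
    exact omegaK_nonneg _ _ _ _ _
  · exact abs_fwdDiff_le_omegaK hg h0 ((le_abs_self h).trans ht) hx.1 hx1.2

theorem exists_whitney_of_continuous (k : ℕ) (hk : 1 ≤ k) {g : ℝ → ℝ} (hg : Continuous g) {ρ : ℝ}
    (hρ : 0 < ρ) (hρ2 : ρ ≤ 2) {y : ℝ} (hy : y ∈ Set.Icc (-1 : ℝ) 1) : ∃ s : ℝ[X], s.degree < k ∧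
      ∀ x ∈ Set.Icc (-1 : ℝ) 1, |g x - s.eval x| ≤
        omegaK g k ρ (-1) 1 * (1 + (2 * k ^ 2) ^ k * (|x - y| / ρ) ^ k) := by
  have hgI : ContinuousOn g (Set.Icc (-1) 1) := hg.continuousOn
  have hkR : (1 : ℝ) ≤ k := by exact_mod_cast hk
  set W := omegaK g k ρ (-1) 1
  have hW : 0 ≤ W := omegaK_nonneg _ _ _ _ _
  set δ := ρ / k with hδ
  have hδ0 : 0 < δ := by positivity
  have hkδ : k * δ = ρ := by rw [hδ]; field_simp
  have hiδ : ∀ i ∈ Finset.range k, (0 : ℝ) < ((i + 1 : ℕ) : ℝ) * δ ∧ ((i + 1 : ℕ) : ℝ) * δ ≤ 2 := by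
    intro i hi
    refine ⟨by positivity, ?_⟩
    have : ((i + 1 : ℕ) : ℝ) ≤ k := by exact_mod_cast Finset.mem_range.1 hi
    nlinarith
  let T : ℕ → ℝ → ℝ := fun i => (steklov (i * δ / k))^[k] g
  let c : ℕ → ℝ := fun i => (-1) ^ (k - i) * (k.choose i : ℝ)
  let G : ℝ → ℝ := fun x => ∑ i ∈ Finset.range k,
    (-((-1) ^ k * c (i + 1))) * T (i + 1) ((1 - (i + 1 : ℕ) * δ / 2) * x - (i + 1 : ℕ) * δ / 2)
  have hT0 : ∀ x, T 0 x = g x := by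
    have h0 : steklov 0 = id := by
      ext g x
      simp [steklov]
    intro x
    simp [T, h0]
  have hc0 : (-1) ^ k * c 0 = 1 := by
    simp [c, ← mul_pow]
  have hdiff : ∀ x ∈ Set.Icc (-1 : ℝ) 1, |g x - G x| ≤ W := by
    intro x hx
    have h1 := abs_sum_steklov_le (Finset.range (k + 1)) c
      (fun i => x + i * (-(δ * (1 + x) / 2))) (fun i => i * δ / k) hg (W := W) k 0 (by
        intro v hv hv1
        have h2 := abs_fwdDiff_le_omegaK' hk hgI (h := δ * (v / k - (1 + x) / 2)) (t := ρ) (x := x) ?_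
          hx ?_
        · rw [fwdDiff_iter_eq_sum] at h2
          convert h2 using 5
          ring
        · have h3 : 0 ≤ v / k := by positivity
          have h4 : v / k ≤ 1 := by rw [div_le_one (by linarith)]; linarith
          have h5 : |v / k - (1 + x) / 2| ≤ 1 := by
            rw [abs_le]; constructor <;> linarith [hx.1, hx.2]
          rw [abs_mul, abs_of_pos hδ0]
          nlinarith
        · have h3 : 0 ≤ v / k := by positivity
          have h4 : v / k ≤ 1 := by rw [div_le_one (by linarith)]; linarith
          have e : x + k * (δ * (v / k - (1 + x) / 2)) = x + ρ * (v / k - (1 + x) / 2) := by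
            rw [← hkδ]; ring
          rw [e]
          have := hx.1
          have := hx.2
          constructor <;> nlinarith)
    have e : |g x - G x| =
        |∑ i ∈ Finset.range (k + 1), c i * T i (x + i * (-(δ * (1 + x) / 2)) + i * δ / k * 0)| := by
      rw [Finset.sum_range_succ']
      have e1 : ∀ i : ℕ, x + (i : ℕ) * (-(δ * (1 + x) / 2)) + (i : ℕ) * δ / k * 0 =
          (1 - (i : ℕ) * δ / 2) * x - (i : ℕ) * δ / 2 := by intro i; ring
      simp only [e1]
      have e2 : g x - G x = (-1) ^ k * (∑ i ∈ Finset.range k, c (i + 1) *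
          T (i + 1) ((1 - (i + 1 : ℕ) * δ / 2) * x - (i + 1 : ℕ) * δ / 2) + c 0 * g x) := by
        have : (-1) ^ k * (c 0 * g x) = g x := by rw [← mul_assoc, hc0, one_mul]
        rw [mul_add, this, Finset.mul_sum, add_comm, sub_eq_add_neg]
        congr 1
        simp only [G, ← Finset.sum_neg_distrib]
        refine Finset.sum_congr rfl fun i _ => ?_
        ring
      rw [e2, abs_mul, abs_pow, abs_neg, abs_one, one_pow, one_mul]
      simp [hT0]
    rw [e]
    exact h1
  have hTc : ∀ i ∈ Finset.range k, ContDiff ℝ k (T (i + 1)) ∧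
      iteratedDeriv k (T (i + 1)) = (((i + 1 : ℕ) * δ / k)⁻¹) ^ k • (fwdDiff ((i + 1 : ℕ) * δ / k))^[k] g := by
    intro i hi
    exact contDiff_steklov_iterate (by have := (hiδ i hi).1; positivity) hg k
  have hTaff : ∀ i ∈ Finset.range k, ContDiff ℝ k fun x : ℝ =>
      (-((-1) ^ k * c (i + 1))) * T (i + 1) ((1 - (i + 1 : ℕ) * δ / 2) * x - (i + 1 : ℕ) * δ / 2) := by
    intro i hi
    have := (hTc i hi).1
    fun_prop
  have hG : ContDiff ℝ k G := ContDiff.sum fun i hi => hTaff i hi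
  have hGk : ∀ x ∈ Set.Icc (-1 : ℝ) 1, |iteratedDeriv k G x| ≤ (2 * k ^ 2) ^ k / ρ ^ k * W := by
    intro x hx
    have e : iteratedDeriv k G x = ∑ i ∈ Finset.range k, (-((-1) ^ k * c (i + 1))) *
        ((1 - (i + 1 : ℕ) * δ / 2) ^ k * ((((i + 1 : ℕ) * δ / k)⁻¹) ^ k *
          (fwdDiff ((i + 1 : ℕ) * δ / k))^[k] g
            ((1 - (i + 1 : ℕ) * δ / 2) * x - (i + 1 : ℕ) * δ / 2))) := by
      rw [iteratedDeriv_fun_sum fun i hi => (hTaff i hi).contDiffAt]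
      refine Finset.sum_congr rfl fun i hi => ?_
      have h1 := (hTc i hi).1
      have h2 : ContDiff ℝ k fun z : ℝ => T (i + 1) (z - (i + 1 : ℕ) * δ / 2) := by fun_prop
      rw [iteratedDeriv_const_mul _ (by fun_prop)]
      have h3 := congrFun (iteratedDeriv_comp_const_mul h2 (1 - (i + 1 : ℕ) * δ / 2)) x
      rw [h3, iteratedDeriv_comp_sub_const, (hTc i hi).2]
      rfl
    rw [e]
    have hterm : ∀ i ∈ Finset.range k, |(-((-1) ^ k * c (i + 1))) *
        ((1 - (i + 1 : ℕ) * δ / 2) ^ k * ((((i + 1 : ℕ) * δ / k)⁻¹) ^ k *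
          (fwdDiff ((i + 1 : ℕ) * δ / k))^[k] g
            ((1 - (i + 1 : ℕ) * δ / 2) * x - (i + 1 : ℕ) * δ / 2)))| ≤
        (k.choose (i + 1) : ℝ) * (((k : ℝ) ^ 2) ^ k / ρ ^ k * W) := by
      intro i hi
      obtain ⟨h1, h2⟩ := hiδ i hi
      set j : ℝ := ((i + 1 : ℕ) : ℝ) with hj
      have hj1 : 1 ≤ j := by rw [hj]; push_cast; linarith [Nat.cast_nonneg (α := ℝ) i]
      have h3 : |c (i + 1)| = (k.choose (i + 1) : ℝ) := by
        simp [c, abs_mul]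
      have h4 : |(1 - j * δ / 2) ^ k| ≤ 1 := by
        rw [abs_pow]
        refine pow_le_one₀ (abs_nonneg _) ?_
        rw [abs_le]; constructor <;> linarith
      have h5 : |((j * δ / k)⁻¹) ^ k| ≤ ((k : ℝ) ^ 2) ^ k / ρ ^ k := by
        rw [← div_pow, abs_of_pos (by positivity)]
        gcongr
        rw [← hkδ, inv_div, div_le_div_iff₀ (by positivity) (by positivity)]
        nlinarith [mul_nonneg (mul_nonneg (sq_nonneg (k : ℝ)) hδ0.le) (sub_nonneg.2 hj1)]
      have h6 : |(fwdDiff (j * δ / k))^[k] g ((1 - j * δ / 2) * x - j * δ / 2)| ≤ W := by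
        have := hx.1
        have := hx.2
        have e7 : (k : ℝ) * (j * δ / k) = j * δ := by field_simp
        refine abs_fwdDiff_le_omegaK hgI (by positivity) ?_ (by nlinarith) ?_
        · rw [div_le_iff₀ (by linarith)]
          have : j ≤ k := by rw [hj]; exact_mod_cast Finset.mem_range.1 hi
          nlinarith
        · rw [e7]; nlinarith
      rw [abs_mul, abs_neg, abs_mul, abs_pow, abs_neg, abs_one, one_pow, one_mul, h3, abs_mul,
        abs_mul]
      refine mul_le_mul_of_nonneg_left ?_ (Nat.cast_nonneg _)
      rw [← one_mul (_ / _ * W)]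
      gcongr
    refine (Finset.abs_sum_le_sum_abs _ _).trans ((Finset.sum_le_sum hterm).trans ?_)
    rw [← Finset.sum_mul]
    have h8 : ∑ i ∈ Finset.range k, (k.choose (i + 1) : ℝ) ≤ 2 ^ k := by
      have := Nat.sum_range_choose k
      rw [Finset.sum_range_succ'] at this
      have h9 : ∑ i ∈ Finset.range k, k.choose (i + 1) ≤ 2 ^ k := by omega
      exact_mod_cast h9
    rw [mul_pow, mul_div_assoc, mul_assoc]
    gcongr
  obtain ⟨s, hs, -, hse⟩ := exists_taylor hy (s := 0)
    (b := fun _ => (2 * k ^ 2) ^ k / ρ ^ k * W) (fun _ _ _ _ => le_rfl) (m := 0) (by simp) k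
    (fun l => iteratedDeriv l G) (fun l hl x _ => by
      rw [iteratedDeriv_succ]
      exact (hG.differentiable_iteratedDeriv l (by exact_mod_cast hl) x).hasDerivAt.hasDerivWithinAt)
    (fun x hx => by simpa using hGk x hx)
  refine ⟨s, by simpa using hs, fun x hx => ?_⟩
  have h1 := hdiff x hx
  have h2 := hse x hx
  rw [iteratedDeriv_zero] at h2
  calc |g x - s.eval x| ≤ |g x - G x| + |G x - s.eval x| := abs_sub_le _ _ _
    _ ≤ W + |x - y| ^ k * ((2 * k ^ 2) ^ k / ρ ^ k * W) := add_le_add h1 h2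
    _ = _ := by rw [div_pow]; field_simp

end Whitney

section LocalModels

variable {r k n : ℕ} {f : ℝ → ℝ}

lemma omegaK_congr {g g' : ℝ → ℝ} (h : Set.EqOn g g' (Set.Icc (-1) 1)) (k : ℕ) (t : ℝ) :
    omegaK g k t (-1) 1 = omegaK g' k t (-1) 1 := by
  unfold omegaK
  congr 1
  ext v
  constructor
  all_goals
    rintro ⟨s, x, h0, ht, hx, hx1, rfl⟩
    refine ⟨s, x, h0, ht, hx, hx1, ?_⟩
    congr 1
    refine Finset.sum_congr rfl fun i hi => ?_
    have hi' : (i : ℝ) ≤ k := by exact_mod_cast Nat.lt_succ_iff.1 (Finset.mem_range.1 hi)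
    have hi0 : 0 ≤ (i : ℝ) * s := by positivity
    rw [h ⟨by linarith, by nlinarith⟩]

theorem exists_whitney (k : ℕ) (hk : 1 ≤ k) {g : ℝ → ℝ} (hg : ContinuousOn g (Set.Icc (-1) 1))
    {ρ : ℝ} (hρ : 0 < ρ) (hρ2 : ρ ≤ 2) {y : ℝ} (hy : y ∈ Set.Icc (-1 : ℝ) 1) :
    ∃ s : ℝ[X], s.degree < k ∧ ∀ x ∈ Set.Icc (-1 : ℝ) 1, |g x - s.eval x| ≤
      omegaK g k ρ (-1) 1 * (1 + (2 * k ^ 2) ^ k * (|x - y| / ρ) ^ k) := by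
  have h1 : (-1 : ℝ) ≤ 1 := by norm_num
  have he : Set.EqOn g (Set.IccExtend h1 (Set.domRestrict (Set.Icc (-1) 1) g)) (Set.Icc (-1) 1) := by
    intro x hx
    rw [Set.IccExtend_of_mem _ _ hx]
    rfl
  obtain ⟨s, hs, hse⟩ := exists_whitney_of_continuous k hk
    (hg.domRestrict.Icc_extend' (h := h1)) hρ hρ2 hy
  refine ⟨s, hs, fun x hx => ?_⟩
  rw [he hx, omegaK_congr he]
  exact hse x hx

/-- The right-hand side `ρ_n(x)^r ω_k(f^(r), ρ_n(x))` of the pointwise estimate. -/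
noncomputable def modulusBound (r k n : ℕ) (f : ℝ → ℝ) (x : ℝ) : ℝ :=
  rho n x ^ r * omegaK (iteratedDerivWithin r f (Set.Icc (-1) 1)) k (rho n x) (-1) 1

lemma modulusBound_nonneg (hn : 1 ≤ n) (x : ℝ) : 0 ≤ modulusBound r k n f x :=
  mul_nonneg (pow_nonneg (rho_pos hn x).le _) (omegaK_nonneg _ _ _ _ _)

lemma uniqueDiffOn_interval : UniqueDiffOn ℝ (Set.Icc (-1 : ℝ) 1) :=
  uniqueDiffOn_Icc (by norm_num)

lemma modulusBound_le_of_rho_le (hf : ContDiffOn ℝ r f (Set.Icc (-1) 1)) {m : ℕ} {c x y : ℝ}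
    (hc : 1 ≤ c) (hx : 0 ≤ rho n x) (h : rho n x ≤ c * rho m y) :
    modulusBound r k n f x ≤ (2 * c) ^ (r + k) * modulusBound r k m f y := by
  have hg := hf.continuousOn_iteratedDerivWithin le_rfl uniqueDiffOn_interval
  have h1 := omegaK_le_mul (k := k) hg hc h
  have h2 : 0 ≤ rho m y := by nlinarith
  have h0 := omegaK_nonneg (iteratedDerivWithin r f (Set.Icc (-1) 1)) k (rho m y) (-1) 1
  have h0' := omegaK_nonneg (iteratedDerivWithin r f (Set.Icc (-1) 1)) k (rho n x) (-1) 1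
  unfold modulusBound
  calc _ ≤ (2 * c * rho m y) ^ r * ((2 * c) ^ k *
        omegaK (iteratedDerivWithin r f (Set.Icc (-1) 1)) k (rho m y) (-1) 1) := by
        gcongr
        nlinarith
    _ = _ := by ring

theorem exists_local_taylor (hk : 1 ≤ k) (hn : 1 ≤ n) (hf : ContDiffOn ℝ r f (Set.Icc (-1) 1))
    {y : ℝ} (hy : y ∈ Set.Icc (-1 : ℝ) 1) : ∃ q : ℝ[X], q.degree < (k + r : ℕ) ∧
      (∀ i < r, (derivative^[i] q).eval y = iteratedDerivWithin i f (Set.Icc (-1) 1) y) ∧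
      ∀ x ∈ Set.Icc (-1 : ℝ) 1, |f x - q.eval x| ≤ modulusBound r k n f y *
        ((|x - y| / rho n y) ^ r * (1 + (2 * k ^ 2) ^ k * (|x - y| / rho n y) ^ k)) := by
  have hρ := rho_pos hn y
  have hρ2 : rho n y ≤ 2 := (rho_le hn y).trans
    (div_le_self (by norm_num) (by exact_mod_cast hn))
  have hg := hf.continuousOn_iteratedDerivWithin le_rfl uniqueDiffOn_interval
  have hW := omegaK_nonneg (iteratedDerivWithin r f (Set.Icc (-1) 1)) k (rho n y) (-1) 1
  obtain ⟨s, hs, hse⟩ := exists_whitney k hk hg hρ hρ2 hy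
  obtain ⟨q, hq, hqi, hqe⟩ := exists_taylor hy (s := s)
    (b := fun u => omegaK (iteratedDerivWithin r f (Set.Icc (-1) 1)) k (rho n y) (-1) 1 *
      (1 + (2 * k ^ 2) ^ k * (u / rho n y) ^ k)) (fun u v hu huv => by gcongr) hs r
    (fun l => iteratedDerivWithin l f (Set.Icc (-1) 1)) (fun l hl x hx => by
      rw [iteratedDerivWithin_succ]
      exact (hf.differentiableOn_iteratedDerivWithin (by exact_mod_cast hl) uniqueDiffOn_interval
        x hx).hasDerivWithinAt) hse
  refine ⟨q, hq, hqi, fun x hx => ?_⟩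
  have h := hqe x hx
  rw [iteratedDerivWithin_zero] at h
  refine h.trans (le_of_eq ?_)
  unfold modulusBound
  rw [div_pow _ _ r]
  field_simp

/-- Local polynomial models of `f` at every point `y`, matching the first `a'` (resp. `a`)
derivatives of `f` at the end points (resp. in the interior), nonnegative up to an error vanishing
to order `μ'` (resp. `μ`) at `y`. -/
def HasLocalModels (r k a μ a' μ' : ℕ) : Prop :=
  ∃ (B : ℝ) (E L : ℕ), 0 < B ∧ ∀ n : ℕ, 1 ≤ n → ∀ f : ℝ → ℝ,
    ContDiffOn ℝ r f (Set.Icc (-1) 1) → (∀ x ∈ Set.Icc (-1 : ℝ) 1, 0 ≤ f x) →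
    ∀ y ∈ Set.Icc (-1 : ℝ) 1, ∃ q : ℝ[X], q.natDegree ≤ L ∧
      (∀ x ∈ Set.Icc (-1 : ℝ) 1,
        |f x - q.eval x| ≤ B * modulusBound r k n f y * angDist n x y ^ E) ∧
      ((y = 1 ∨ y = -1) →
        (∀ i < a', (derivative^[i] q).eval y = iteratedDerivWithin i f (Set.Icc (-1) 1) y) ∧
        ∀ x ∈ Set.Icc (-1 : ℝ) 1, |x - y| ≤ rho n y →
          -(B * modulusBound r k n f y * (|x - y| / rho n y) ^ μ') ≤ q.eval x) ∧
      ((∀ x, |x - y| ≤ rho n y → x ∈ Set.Icc (-1 : ℝ) 1) →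
        (∀ i < a, (derivative^[i] q).eval y = iteratedDerivWithin i f (Set.Icc (-1) 1) y) ∧
        ∀ x ∈ Set.Icc (-1 : ℝ) 1, |x - y| ≤ rho n y →
          -(B * modulusBound r k n f y * (|x - y| / rho n y) ^ μ) ≤ q.eval x)

/-- The growth factor of the local Taylor estimate is at most a power of `angDist`. -/
lemma growth_le {K : ℝ} (hK : 0 ≤ K) (hn : 1 ≤ n) {x y : ℝ} (hx : x ∈ Set.Icc (-1 : ℝ) 1)
    (hy : y ∈ Set.Icc (-1 : ℝ) 1) {a b N : ℕ} (h : a + b ≤ N) :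
    (|x - y| / rho n y) ^ a * (1 + K * (|x - y| / rho n y) ^ b) ≤
      (1 + K) * angDist n x y ^ (2 * N) := by
  have hρ := rho_pos hn y
  have hd := one_le_angDist n x y
  have h1 : |x - y| / rho n y ≤ angDist n x y ^ 2 := by
    rw [div_le_iff₀ hρ, mul_comm]
    exact abs_sub_le_rho_mul hn hx hy
  set t := |x - y| / rho n y
  have ht : 0 ≤ t := by positivity
  have h2 : 1 ≤ angDist n x y ^ 2 := one_le_pow₀ hd
  calc t ^ a * (1 + K * t ^ b) ≤ (angDist n x y ^ 2) ^ a *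
        ((angDist n x y ^ 2) ^ b + K * (angDist n x y ^ 2) ^ b) := by
        gcongr
        exact one_le_pow₀ h2
    _ = (1 + K) * (angDist n x y ^ 2) ^ (a + b) := by ring
    _ ≤ (1 + K) * (angDist n x y ^ 2) ^ N := by gcongr
    _ = _ := by rw [← pow_mul]

theorem hasLocalModels_of_le (hk : 1 ≤ k) {μ μ' : ℕ} (hμ : μ ≤ r) (hμ' : μ' ≤ r) :
    HasLocalModels r k μ μ μ' μ' := by
  refine ⟨1 + (2 * k ^ 2) ^ k, 2 * (r + k), k + r, by positivity, fun n hn f hf hf0 y hy => ?_⟩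
  obtain ⟨q, hq, hqi, hqe⟩ := exists_local_taylor hk hn hf hy
  have hΨ : 0 ≤ modulusBound r k n f y := modulusBound_nonneg hn y
  have hlow : ∀ ν ≤ r, ∀ x ∈ Set.Icc (-1 : ℝ) 1, |x - y| ≤ rho n y →
      -((1 + (2 * k ^ 2) ^ k) * modulusBound r k n f y * (|x - y| / rho n y) ^ ν) ≤ q.eval x := by
    intro ν hν x hx hxy
    have ht : 0 ≤ |x - y| / rho n y := div_nonneg (abs_nonneg _) (rho_pos hn y).le
    have ht1 : |x - y| / rho n y ≤ 1 := (div_le_one (rho_pos hn y)).2 hxy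
    have h1 := (abs_le.1 (hqe x hx)).2
    have h2 := hf0 x hx
    set t := |x - y| / rho n y
    have h3 : modulusBound r k n f y * (t ^ r * (1 + (2 * k ^ 2) ^ k * t ^ k)) ≤
        modulusBound r k n f y * (t ^ ν * (1 + (2 * k ^ 2) ^ k * 1)) := by
      gcongr ?_ * (?_ * (_ + _ * ?_))
      · exact pow_le_pow_of_le_one ht ht1 hν
      · exact pow_le_one₀ ht ht1
    linarith
  refine ⟨q, natDegree_le_of_degree_le hq.le, fun x hx => (hqe x hx).trans ?_,
    fun _ => ⟨fun i hi => hqi i (by omega), hlow _ hμ'⟩,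
    fun _ => ⟨fun i hi => hqi i (by omega), hlow _ hμ⟩⟩
  have := growth_le (K := (2 * k ^ 2) ^ k) (by positivity) hn hx hy le_rfl (a := r) (b := k)
  calc _ ≤ modulusBound r k n f y * ((1 + (2 * k ^ 2) ^ k) * angDist n x y ^ (2 * (r + k))) := by
        gcongr
    _ = _ := by ring

end LocalModels

section SpecialLocalModels

/-- Adjusting the linear coefficient of a cubic which is almost nonnegative near `0`. -/
lemma exists_cubic_adjust {e d a b U : ℝ} (he : 0 ≤ e) (hU : 0 ≤ U)
    (h : ∀ t, |t| ≤ 1 → -(U * |t|) ≤ e + d * t + a * t ^ 2 + b * t ^ 3) :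
    ∃ d', |d' - d| ≤ U ∧ ∀ t, |t| ≤ 1 → -(2 * U * t ^ 2) ≤ e + d' * t + a * t ^ 2 + b * t ^ 3 := by
  have key : ∀ d b : ℝ, (∀ t, |t| ≤ 1 → -(U * |t|) ≤ e + d * t + a * t ^ 2 + b * t ^ 3) → d < -U →
      ∀ t, |t| ≤ 1 → -(2 * U * t ^ 2) ≤ e + (d + U) * t + a * t ^ 2 + b * t ^ 3 := by
    intro d b h hd t ht
    have h1 := h 1 (by simp)
    have h2 := h (-1) (by simp)
    simp only [abs_neg, abs_one] at h1 h2
    rcases le_total 0 t with h0 | h0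
    · have := h t ht
      rw [abs_of_nonneg h0] at this
      nlinarith [mul_nonneg hU (sq_nonneg t)]
    · obtain ⟨s, rfl⟩ : ∃ s, t = -s := ⟨-t, by ring⟩
      have hs0 : 0 ≤ s := by linarith
      have hs1 : s ≤ 1 := by rwa [abs_neg, abs_of_nonneg hs0] at ht
      have hw : 0 < -(d + U) := by linarith
      have hs2 : s ^ 2 ≤ s := by nlinarith
      have hs3 : s ^ 3 ≤ s ^ 2 := by nlinarith [sq_nonneg s]
      have hs3' : 0 ≤ s ^ 3 := by positivity
      have h3 : 0 ≤ -(d + U) * (s - s ^ 2) := mul_nonneg hw.le (by linarith)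
      have h4 : 0 ≤ e * (1 - s ^ 2) := mul_nonneg he (by linarith)
      have h5 : 0 ≤ e + -(d + U) + (a + 2 * U) - b := by linarith
      rcases le_total 0 b with hb | hb
      · have h6 : 0 ≤ b * (s ^ 2 - s ^ 3) := mul_nonneg hb (by linarith)
        have h7 := mul_nonneg h5 (sq_nonneg s)
        nlinarith
      · have h6 : 0 ≤ -b * s ^ 3 := mul_nonneg (by linarith) hs3'
        have h8 : 0 ≤ -(d + U) * s := mul_nonneg hw.le hs0
        rcases le_total 0 (a + 2 * U) with ha | ha
        · have := mul_nonneg ha (sq_nonneg s)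
          nlinarith
        · have h7 : 0 ≤ -(a + 2 * U) * (1 - s ^ 2) := mul_nonneg (by linarith) (by linarith)
          nlinarith
  rcases lt_or_ge d (-U) with h1 | h1
  · exact ⟨d + U, by simp [abs_of_nonneg hU], key d b h h1⟩
  rcases lt_or_ge U d with h2 | h2
  · refine ⟨d - U, by simp [abs_of_nonneg hU], fun t ht => ?_⟩
    have := key (-d) (-b) (fun t ht => by
      have := h (-t) (by simpa using ht)
      rw [abs_neg] at this
      linarith [show (-t) ^ 3 = -t ^ 3 by ring, show (-t) ^ 2 = t ^ 2 by ring,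
        show b * (-t) ^ 3 = -b * t ^ 3 by ring, show a * (-t) ^ 2 = a * t ^ 2 by ring])
      (by linarith) (-t) (by simpa using ht)
    have e1 : (-t) ^ 2 = t ^ 2 := by ring
    have e2 : -b * (-t) ^ 3 = b * t ^ 3 := by ring
    rw [e1, e2] at this
    linarith
  · refine ⟨0, by rw [zero_sub, abs_neg]; exact abs_le.2 ⟨h1, h2⟩, fun t ht => ?_⟩
    have h3 := h 1 (by simp)
    have h4 := h (-1) (by simp)
    simp only [abs_neg, abs_one] at h3 h4
    obtain ⟨ht0, ht1⟩ := abs_le.1 ht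
    have h5 : 0 ≤ (e + a + 2 * U + b) * (1 + t) := mul_nonneg (by linarith) (by linarith)
    have h6 : 0 ≤ (e + a + 2 * U - b) * (1 - t) := mul_nonneg (by linarith) (by linarith)
    have h7 : 0 ≤ e * (1 - t ^ 2) := mul_nonneg he (by nlinarith)
    have h8 : 0 ≤ (e + a + 2 * U + b * t) * t ^ 2 :=
      mul_nonneg (by linarith) (sq_nonneg t)
    nlinarith

variable {k n : ℕ}

theorem hasLocalModels_one (hk : 1 ≤ k) (hk3 : k ≤ 3) : HasLocalModels 1 k 1 2 1 1 := by
  classical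
  set K : ℝ := (2 * k ^ 2) ^ k with hK
  have hK0 : 0 ≤ K := by positivity
  obtain ⟨B, E, L, hB, H⟩ := hasLocalModels_of_le (r := 1) (k := k) hk (le_refl 1) (le_refl 1)
  refine ⟨max B (2 * (1 + K)), max E (2 * (1 + k)), max L 4, lt_max_of_lt_left hB,
    fun n hn f hf hf0 y hy => ?_⟩
  have hΨ : 0 ≤ modulusBound 1 k n f y := modulusBound_nonneg hn y
  set Ψ := modulusBound 1 k n f y
  have hρ := rho_pos hn y
  have hd := fun x => one_le_angDist n x y
  by_cases hz : ∀ x, |x - y| ≤ rho n y → x ∈ Set.Icc (-1 : ℝ) 1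
  · obtain ⟨q, hq, hqi, hqe⟩ := exists_local_taylor hk hn hf hy
    set ρ := rho n y
    have hq0 : q.eval y = f y := by simpa using hqi 0 zero_lt_one
    set U := (1 + K) * Ψ with hUdef
    have hU : 0 ≤ U := by positivity
    let p := q.comp (C ρ * X + C y)
    have hp : p.natDegree < 4 := by
      have h1 : q.natDegree ≤ 3 :=
        natDegree_le_iff_coeff_eq_zero.2 fun i hi => coeff_eq_zero_of_degree_lt (hq.trans_le (by
          norm_cast
          omega))
      have h2 : (C ρ * X + C y : ℝ[X]).natDegree ≤ 1 := natDegree_linear_le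
      have := natDegree_comp_le (p := q) (q := C ρ * X + C y)
      have h3 : p.natDegree ≤ 3 * 1 := this.trans (Nat.mul_le_mul h1 h2)
      omega
    have hpe : ∀ t, q.eval (y + ρ * t) =
        q.eval y + p.coeff 1 * t + p.coeff 2 * t ^ 2 + p.coeff 3 * t ^ 3 := by
      intro t
      have h1 : p.eval t = q.eval (y + ρ * t) := by simp [p, add_comm]
      have h2 : p.eval 0 = q.eval y := by simp [p]
      rw [← h1, ← h2, eval_eq_sum_range' hp, eval_eq_sum_range' hp]
      simp [Finset.sum_range_succ]
    obtain ⟨d', hd', hd'2⟩ := exists_cubic_adjust (e := q.eval y) (d := p.coeff 1) (a := p.coeff 2)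
      (b := p.coeff 3) (U := U) (hq0 ▸ hf0 y hy) hU (by
        intro t ht
        rw [← hpe]
        have hx : |y + ρ * t - y| ≤ ρ := by
          rw [add_sub_cancel_left, abs_mul, abs_of_pos hρ]
          nlinarith
        have hxI := hz _ hx
        have h1 := (abs_le.1 (hqe _ hxI)).2
        have h2 := hf0 _ hxI
        rw [add_sub_cancel_left, abs_mul, abs_of_pos hρ, mul_div_cancel_left₀ _ hρ.ne', pow_one] at h1
        have h3 : Ψ * (|t| * (1 + K * |t| ^ k)) ≤ Ψ * (|t| * (1 + K * 1)) := by
          gcongr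
          exact pow_le_one₀ (abs_nonneg _) ht
        have e : U * |t| = Ψ * (|t| * (1 + K * 1)) := by rw [hUdef]; ring
        linarith)
    let c := (d' - p.coeff 1) / ρ
    have hev : ∀ x, (q + C c * (X - C y)).eval x = q.eval x + c * (x - y) := by intro x; simp
    refine ⟨q + C c * (X - C y), ?_, fun x hx => ?_, ?_, fun _ => ⟨fun i hi => ?_, fun x hx hxy => ?_⟩⟩
    · refine (natDegree_add_le _ _).trans (max_le ?_ ?_)
      · exact (natDegree_le_of_degree_le hq.le).trans (by omega)
      · refine (natDegree_C_mul_le _ _).trans ?_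
        rw [natDegree_X_sub_C]
        omega
    · rw [hev]
      have h1 := hqe x hx
      have h2 := growth_le hK0 hn hx hy le_rfl (a := 1) (b := k)
      have h3 : |c * (x - y)| ≤ U * (|x - y| / ρ) := by
        rw [abs_mul, abs_div, abs_of_pos hρ, div_mul_eq_mul_div, mul_div_assoc]
        gcongr
      have h4 : |x - y| / ρ ≤ angDist n x y ^ (2 * (1 + k)) := by
        have := growth_le (K := 0) le_rfl hn hx hy (by omega : 1 + 0 ≤ 1 + k)
        simpa using this
      have hD : angDist n x y ^ (2 * (1 + k)) ≤ angDist n x y ^ max E (2 * (1 + k)) :=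
        pow_le_pow_right₀ (hd x) (le_max_right _ _)
      have h5 : |f x - (q.eval x + c * (x - y))| ≤ |f x - q.eval x| + |c * (x - y)| := by
        rw [← sub_sub]; exact abs_sub _ _
      calc _ ≤ _ := h5
        _ ≤ Ψ * ((1 + K) * angDist n x y ^ (2 * (1 + k))) +
            U * angDist n x y ^ (2 * (1 + k)) := by
            refine add_le_add (h1.trans ?_) (h3.trans ?_) <;> gcongr
        _ = 2 * (1 + K) * Ψ * angDist n x y ^ (2 * (1 + k)) := by rw [hUdef]; ring
        _ ≤ _ := by
          have := hd x
          gcongr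
          exact le_max_right _ _
    · intro hy1
      exfalso
      have h1 := (hz (y + ρ) (by simp [abs_of_pos hρ])).2
      have h2 := (hz (y - ρ) (by simp [abs_of_pos hρ])).1
      rcases hy1 with rfl | rfl <;> linarith
    · obtain rfl : i = 0 := by omega
      simpa using hq0
    · rw [hev]
      have h1 := hd'2 ((x - y) / ρ) (by rwa [abs_div, abs_of_pos hρ, div_le_one hρ])
      have h2 := hpe ((x - y) / ρ)
      have e1 : y + ρ * ((x - y) / ρ) = x := by field_simp; ring
      have e2 : c * (x - y) = (d' - p.coeff 1) * ((x - y) / ρ) := by simp only [c]; ring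
      rw [e1] at h2
      rw [e2, h2]
      have h3 : 2 * U * ((x - y) / ρ) ^ 2 ≤ max B (2 * (1 + K)) * Ψ * (|x - y| / ρ) ^ 2 := by
        rw [div_pow _ _ 2, div_pow _ _ 2, sq_abs, hUdef, ← mul_assoc]
        gcongr
        exact le_max_right _ _
      linarith
  · obtain ⟨q, hq, hqe, hqend, -⟩ := H n hn f hf hf0 y hy
    refine ⟨q, hq.trans (le_max_left _ _), fun x hx => (hqe x hx).trans ?_, fun h => ?_,
      fun h => absurd h hz⟩
    · have := hd x
      gcongr
      · exact le_max_left _ _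
      · exact le_max_left _ _
    · refine ⟨(hqend h).1, fun x hx hxy => le_trans ?_ ((hqend h).2 x hx hxy)⟩
      rw [neg_le_neg_iff]
      gcongr
      exact le_max_left _ _

/-- Adjusting the slope of an affine function which is almost nonnegative near `0`. -/
lemma exists_affine_adjust {e d U : ℝ} (he : 0 ≤ e) (hU : 0 ≤ U) (h1 : -U ≤ e + d)
    (h2 : -U ≤ e - d) : ∃ d', |d' - d| ≤ U ∧ ∀ t, |t| ≤ 1 → 0 ≤ e + d' * t := by
  refine ⟨max (-e) (min d e), ?_, fun t ht => ?_⟩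
  · rcases le_total d e with h | h
    · rcases le_total (-e) d with h' | h'
      · simpa [h, h'] using hU
      · rw [min_eq_left h, max_eq_left h', abs_le]
        constructor <;> linarith
    · rw [min_eq_right h, max_eq_right (by linarith), abs_le]
      constructor <;> linarith
  · have h3 : |max (-e) (min d e)| ≤ e :=
      abs_le.2 ⟨le_max_left _ _, max_le (by linarith) (min_le_right _ _)⟩
    have h4 : |max (-e) (min d e) * t| ≤ e * 1 := by
      rw [abs_mul]
      gcongr
    linarith [neg_abs_le (max (-e) (min d e) * t)]

theorem hasLocalModels_zero : HasLocalModels 0 2 1 2 1 1 := by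
  set K : ℝ := (2 * (2 : ℕ) ^ 2) ^ 2 with hK
  have hK0 : 0 ≤ K := by positivity
  refine ⟨2 * (2 + K), 4, 1, by positivity, fun n hn f hf hf0 y hy => ?_⟩
  have hΨ : 0 ≤ modulusBound 0 2 n f y := modulusBound_nonneg hn y
  obtain ⟨q, hq, -, hqe⟩ := exists_local_taylor one_le_two hn hf hy
  set Ψ := modulusBound 0 2 n f y
  have hρ := rho_pos hn y
  set ρ := rho n y
  have hq1 : q.natDegree ≤ 1 :=
    natDegree_le_iff_coeff_eq_zero.2 fun i hi => coeff_eq_zero_of_degree_lt (hq.trans_le (by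
      norm_cast))
  set e := f y with he
  have he0 : 0 ≤ e := hf0 y hy
  let D := q.coeff 1 * ρ
  have hqx : ∀ x, q.eval x = q.eval y + D * ((x - y) / ρ) := by
    intro x
    rw [eval_eq_sum_range' (Nat.lt_succ_of_le hq1), eval_eq_sum_range' (Nat.lt_succ_of_le hq1)]
    simp only [Finset.sum_range_succ, D]
    field_simp
    simp
    ring
  have hqy : |e - q.eval y| ≤ Ψ := by simpa using hqe y hy
  have herr : ∀ x ∈ Set.Icc (-1 : ℝ) 1,
      |f x - (e + D * ((x - y) / ρ))| ≤ Ψ * (2 + K * (|x - y| / ρ) ^ 2) := by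
    intro x hx
    have h1 := hqe x hx
    rw [pow_zero, one_mul, hqx] at h1
    have e1 : f x - (e + D * ((x - y) / ρ)) =
        (f x - (q.eval y + D * ((x - y) / ρ))) - (e - q.eval y) := by ring
    rw [e1]
    refine (abs_sub _ _).trans ((add_le_add h1 hqy).trans (le_of_eq ?_))
    ring
  set U := (2 + K) * Ψ with hU
  have hU0 : 0 ≤ U := by positivity
  have hgrow : ∀ x ∈ Set.Icc (-1 : ℝ) 1, 2 + K * (|x - y| / ρ) ^ 2 ≤ (2 + K) * angDist n x y ^ 4 := by
    intro x hx
    have h1 := growth_le hK0 hn hx hy (by norm_num : 0 + 2 ≤ 2)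
    have h2 : 1 ≤ angDist n x y ^ 4 := one_le_pow₀ (one_le_angDist n x y)
    simp only [pow_zero, one_mul] at h1
    linarith
  have hlow : ∀ x ∈ Set.Icc (-1 : ℝ) 1, |x - y| ≤ ρ → -U ≤ e + D * ((x - y) / ρ) := by
    intro x hx hxy
    have h1 := (abs_le.1 (herr x hx)).2
    have h2 := hf0 x hx
    have h3 : Ψ * (2 + K * (|x - y| / ρ) ^ 2) ≤ Ψ * (2 + K * 1) := by
      gcongr
      exact pow_le_one₀ (by positivity) ((div_le_one hρ).2 hxy)
    rw [hU]
    linarith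
  have hev : ∀ d x, (C (d / ρ) * (X - C y) + C e : ℝ[X]).eval x = e + d * ((x - y) / ρ) := by
    intro d x
    simp
    ring
  have hdeg : ∀ d, (C (d / ρ) * (X - C y) + C e : ℝ[X]).natDegree ≤ 1 := by
    intro d
    rw [natDegree_add_C]
    exact (natDegree_C_mul_le _ _).trans (natDegree_X_sub_C_le _)
  have happrox : ∀ d, |d - D| ≤ U → ∀ x ∈ Set.Icc (-1 : ℝ) 1, |f x - (e + d * ((x - y) / ρ))| ≤
        (2 * (2 + K)) * Ψ * angDist n x y ^ 4 := by
    intro d hd x hx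
    have h1 := herr x hx
    have h2 := hgrow x hx
    have h3 := growth_le (K := 0) le_rfl hn hx hy (by norm_num : 1 + 0 ≤ 2)
    have h4 : |(d - D) * ((x - y) / ρ)| ≤ U * angDist n x y ^ 4 := by
      rw [abs_mul, abs_div, abs_of_pos hρ]
      gcongr
      simpa using h3
    have e1 : f x - (e + d * ((x - y) / ρ)) =
        (f x - (e + D * ((x - y) / ρ))) - (d - D) * ((x - y) / ρ) := by ring
    rw [e1]
    have h5 : Ψ * (2 + K * (|x - y| / ρ) ^ 2) ≤ Ψ * ((2 + K) * angDist n x y ^ 4) := by gcongr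
    calc _ ≤ _ := abs_sub _ _
      _ ≤ Ψ * ((2 + K) * angDist n x y ^ 4) + U * angDist n x y ^ 4 := add_le_add (h1.trans h5) h4
      _ = _ := by rw [hU]; ring
  have hBt : ∀ x, ∀ m : ℕ, 0 ≤ 2 * (2 + K) * Ψ * (|x - y| / ρ) ^ m := by
    intro x m
    positivity
  have h0 : ∀ d, ∀ i < 1, (derivative^[i] (C (d / ρ) * (X - C y) + C e : ℝ[X])).eval y =
      iteratedDerivWithin i f (Set.Icc (-1) 1) y := by
    intro d i hi
    obtain rfl : i = 0 := by omega
    simp [he]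
  by_cases hz : ∀ x, |x - y| ≤ ρ → x ∈ Set.Icc (-1 : ℝ) 1
  · have hp : |y + ρ - y| ≤ ρ := by simp [abs_of_pos hρ]
    have hm : |y - ρ - y| ≤ ρ := by simp [abs_of_pos hρ]
    have h1 := hlow _ (hz _ hp) hp
    have h2 := hlow _ (hz _ hm) hm
    rw [add_sub_cancel_left, div_self hρ.ne', mul_one] at h1
    rw [sub_sub_cancel_left, neg_div, div_self hρ.ne', mul_neg_one, ← sub_eq_add_neg] at h2
    obtain ⟨d, hd, hd0⟩ := exists_affine_adjust he0 hU0 h1 h2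
    refine ⟨C (d / ρ) * (X - C y) + C e, hdeg d, fun x hx => ?_, fun hy1 => ?_,
      fun _ => ⟨h0 d, fun x hx hxy => ?_⟩⟩
    · rw [hev]
      exact happrox d hd x hx
    · exfalso
      have h3 := (hz _ hp).2
      have h4 := (hz _ hm).1
      rcases hy1 with rfl | rfl <;> linarith
    · rw [hev]
      have := hd0 ((x - y) / ρ) (by rwa [abs_div, abs_of_pos hρ, div_le_one hρ])
      linarith [hBt x 2]
  · refine ⟨C (D / ρ) * (X - C y) + C e, hdeg D, fun x hx => ?_, fun hy1 => ⟨h0 D, fun x hx hxy => ?_⟩,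
      fun h => absurd h hz⟩
    · rw [hev]
      exact happrox D (by simpa using hU0) x hx
    · rw [hev]
      have hρ1 : ρ ≤ 1 := by
        have hy2 : y ^ 2 = 1 := by rcases hy1 with rfl | rfl <;> norm_num
        have hn2 : (1 : ℝ) ≤ (n : ℝ) ^ 2 := one_le_pow₀ (by exact_mod_cast hn)
        simp only [ρ, rho, hy2, sub_self, Real.sqrt_zero, zero_div, zero_add]
        exact div_le_one_of_le₀ hn2 (by positivity)
      set t := |x - y| / ρ with ht
      have ht0 : 0 ≤ t := by positivity
      have ht1 : t ≤ 1 := (div_le_one hρ).2 hxy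
      have hend : ∃ s : ℝ, (x - y) / ρ = s * t ∧ -U ≤ e + D * s := by
        rcases hy1 with rfl | rfl
        · refine ⟨-1, ?_, ?_⟩
          · rw [ht, abs_of_nonpos (by linarith [hx.2])]; ring
          · have := hlow (1 - ρ) ⟨by linarith, by linarith⟩ (by simp [abs_of_pos hρ])
            rwa [sub_sub_cancel_left, neg_div, div_self hρ.ne'] at this
        · refine ⟨1, ?_, ?_⟩
          · rw [ht, abs_of_nonneg (by linarith [hx.1])]; ring
          · have := hlow (-1 + ρ) ⟨by linarith, by linarith⟩ (by simp [abs_of_pos hρ])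
            rwa [add_sub_cancel_left, div_self hρ.ne'] at this
      obtain ⟨s, hs, hs1⟩ := hend
      rw [hs, pow_one]
      have h3 : 0 ≤ (e + D * s + U) * t := mul_nonneg (by linarith) ht0
      have h4 : 0 ≤ e * (1 - t) := mul_nonneg he0 (by linarith)
      have h5 : 0 ≤ U * t := mul_nonneg hU0 ht0
      have h6 : 2 * (2 + K) * Ψ * t = 2 * (U * t) := by rw [hU]; ring
      nlinarith

end SpecialLocalModels

section Assembly

lemma minGap_le {S : Set ℝ} {u v : ℝ} (hu : u ∈ S) (hv : v ∈ S) (h : u ≠ v) :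
    minGap S ≤ |u - v| :=
  csInf_le ⟨0, by rintro d ⟨u, -, v, -, -, rfl⟩; exact abs_nonneg _⟩ ⟨u, hu, v, hv, h, rfl⟩

lemma minGap_pos {S : Set ℝ} (hS : S.Finite) {u v : ℝ} (hu : u ∈ S) (hv : v ∈ S) (h : u ≠ v) :
    0 < minGap S := by
  have hfin : {d : ℝ | ∃ u ∈ S, ∃ v ∈ S, u ≠ v ∧ d = |u - v|}.Finite := by
    refine (hS.image2 (fun u v => |u - v|) hS).subset ?_
    rintro d ⟨u, hu, v, hv, -, rfl⟩
    exact ⟨u, hu, v, hv, rfl⟩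
  obtain ⟨a, -, b, -, hab, he⟩ := Set.Nonempty.csInf_mem (by exact ⟨_, u, hu, v, hv, h, rfl⟩) hfin
  rw [minGap, he]
  exact abs_pos.2 (sub_ne_zero.2 hab)

lemma iterate_derivative_eval_eq {P q : ℝ[X]} {a : ℝ} {m i : ℕ} (h : (X - C a) ^ m ∣ P - q)
    (hi : i < m) : (derivative^[i] P).eval a = (derivative^[i] q).eval a := by
  have h1 := pow_sub_dvd_iterate_derivative_of_pow_dvd i h
  have h2 : (X - C a) ∣ derivative^[i] (P - q) := (dvd_pow_self _ (by omega)).trans h1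
  rw [dvd_iff_isRoot, IsRoot.def, iterate_derivative_sub, eval_sub, sub_eq_zero] at h2
  exact h2

lemma rho_le_of_le_mul {n N D : ℕ} (hn : 1 ≤ n) (hN : N ≤ D * n) (hN1 : 1 ≤ N) (hD : 1 ≤ D) (x : ℝ) :
    rho n x ≤ (D : ℝ) ^ 2 * rho N x := by
  have hn' : (0 : ℝ) < n := by exact_mod_cast hn
  have hN' : (0 : ℝ) < N := by exact_mod_cast hN1
  have hD' : (1 : ℝ) ≤ D := by exact_mod_cast hD
  have hle : (N : ℝ) ≤ D * n := by exact_mod_cast hN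
  have h1 : 1 / (n : ℝ) ≤ D / N := by
    rw [div_le_div_iff₀ hn' hN', one_mul]
    exact hle
  have h2 : (D : ℝ) / N ≤ D ^ 2 / N := by
    gcongr
    nlinarith
  have h3 := Real.sqrt_nonneg (1 - x ^ 2)
  unfold rho
  calc Real.sqrt (1 - x ^ 2) / n + 1 / (n : ℝ) ^ 2
      = Real.sqrt (1 - x ^ 2) * (1 / n) + (1 / (n : ℝ)) ^ 2 := by ring
    _ ≤ Real.sqrt (1 - x ^ 2) * (D ^ 2 / N) + (D / N) ^ 2 :=
        add_le_add (mul_le_mul_of_nonneg_left (h1.trans h2) h3) (pow_le_pow_left₀ (by positivity) h1 2)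
    _ = _ := by ring

theorem exists_positive_interpolant (p : ℕ) {r k a μ a' μ' : ℕ} (H : HasLocalModels r k a μ a' μ')
    (hμ : Even μ) (ha : a ≤ a') (haμ : a ≤ μ) (ha' : a' ≤ μ') :
    ∃ c : ℝ, 0 < c ∧ ∃ Nf : ℝ → ℕ, ∀ (α : Fin p → ℝ), (∀ j, α j ∈ Set.Icc (-1 : ℝ) 1) →
      ∀ f : ℝ → ℝ, ContDiffOn ℝ r f (Set.Icc (-1 : ℝ) 1) → (∀ x ∈ Set.Icc (-1 : ℝ) 1, 0 ≤ f x) →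
      ∀ n : ℕ, Nf (minGap (Set.range α ∪ {-1, 1})) ≤ n →
      ∃ P : ℝ[X], P.natDegree ≤ n ∧ (∀ x ∈ Set.Icc (-1 : ℝ) 1, 0 ≤ P.eval x) ∧
        (∀ i < a, ∀ j, (derivative^[i] P).eval (α j) =
          iteratedDerivWithin i f (Set.Icc (-1 : ℝ) 1) (α j)) ∧
        (∀ i < a', (derivative^[i] P).eval 1 = iteratedDerivWithin i f (Set.Icc (-1 : ℝ) 1) 1 ∧
          (derivative^[i] P).eval (-1) = iteratedDerivWithin i f (Set.Icc (-1 : ℝ) 1) (-1)) ∧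
        ∀ x ∈ Set.Icc (-1 : ℝ) 1, |f x - P.eval x| ≤ c * modulusBound r k n f x := by
  classical
  obtain ⟨B₀, E₀, L, hB₀, H⟩ := H
  set E := max E₀ (r + k)
  set B := max B₀ (2 ^ (r + k))
  have hB : 0 < B := lt_max_of_lt_left hB₀
  obtain ⟨K, D₀, hK, hmain⟩ := exists_nonneg_interpolant E L (p + 2) (max μ μ') B hB
  set D := max D₀ 1
  have hD : 1 ≤ D := le_max_right _ _
  refine ⟨K * (2 * ((2 * D : ℕ) : ℝ) ^ 2) ^ (r + k), by positivity, fun δ => D * (⌈6 / δ⌉₊ + 1),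
    fun α hα f hf hf0 N hN => ?_⟩
  set S' : Set ℝ := Set.range α ∪ {-1, 1} with hS'
  have h1S : (1 : ℝ) ∈ S' := Or.inr (by simp)
  have h2S : (-1 : ℝ) ∈ S' := Or.inr (by simp)
  have hδ : 0 < minGap S' :=
    minGap_pos ((Set.finite_range α).union (by simp)) h1S h2S (by norm_num)
  set n := N / D with hnD
  have hnge : ⌈6 / minGap S'⌉₊ + 1 ≤ n := (Nat.le_div_iff_mul_le hD).2 (by rw [mul_comm]; exact hN)
  have hn : 1 ≤ n := by omega
  have hn' : (0 : ℝ) < n := by exact_mod_cast hn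
  have hDn : D * n ≤ N := Nat.mul_div_le N D
  have hND : N ≤ 2 * D * n := by
    have h1 := Nat.div_add_mod N D
    have h2 := Nat.mod_lt N hD
    have h3 : D ≤ D * n := Nat.le_mul_of_pos_right D hn
    rw [← hnD] at h1
    have : 2 * D * n = D * n + D * n := by ring
    omega
  have hN1 : 1 ≤ N := (Nat.mul_pos hD hn).trans_le hDn
  have hgap : 6 / (n : ℝ) ≤ minGap S' := by
    rw [div_le_iff₀ hn', ← div_le_iff₀' hδ]
    exact (Nat.le_ceil _).trans (by exact_mod_cast (by omega : ⌈6 / minGap S'⌉₊ ≤ n))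
  let S : Finset ℝ := Finset.image α Finset.univ ∪ {-1, 1}
  have hmem : ∀ {x}, x ∈ S ↔ x ∈ S' := by
    intro x
    simp [S, S']
  have hcard : S.card ≤ p + 2 := by
    refine (Finset.card_union_le _ _).trans (add_le_add ?_ Finset.card_le_two)
    simpa using Finset.card_image_le (s := Finset.univ) (f := α)
  have hSI : ∀ x ∈ S, x ∈ Set.Icc (-1 : ℝ) 1 := by
    intro x hx
    rcases hmem.1 hx with ⟨j, rfl⟩ | h
    · exact hα j
    · rcases h with rfl | rfl <;> norm_num
  have hsep : ∀ x ∈ S, ∀ y ∈ S, x ≠ y → 6 / (n : ℝ) ≤ |x - y| := fun x hx y hy hxy =>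
    hgap.trans (minGap_le (hmem.1 hx) (hmem.1 hy) hxy)
  have hzone : ∀ y ∈ S, ¬ (y = 1 ∨ y = -1) → ∀ x, |x - y| ≤ rho n y → x ∈ Set.Icc (-1 : ℝ) 1 := by
    intro y hy hy1 x hx
    have h1 := hsep 1 (hmem.2 h1S) y hy (fun h => hy1 (Or.inl h.symm))
    have h2 := hsep y hy (-1) (hmem.2 h2S) (fun h => hy1 (Or.inr h))
    rw [abs_of_nonneg (by linarith [(hSI y hy).2])] at h1
    rw [abs_of_nonneg (by linarith [(hSI y hy).1])] at h2
    have h3 : 2 / (n : ℝ) ≤ 6 / n := by gcongr; norm_num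
    obtain ⟨h4, h5⟩ := abs_le.1 (hx.trans ((rho_le hn y).trans h3))
    constructor <;> linarith
  choose! q hqd hqe hqend hqint using H n hn f hf hf0
  let ν : ℝ → ℕ := fun y => if y = 1 ∨ y = -1 then μ' else μ
  have hE : ∀ x y, 1 ≤ angDist n x y := one_le_angDist n
  have hΨ : ∀ x, 0 ≤ modulusBound r k n f x := modulusBound_nonneg hn
  obtain ⟨P, hPd, hP0, hPi, hPe⟩ := hmain n hn S hcard hSI hsep f (modulusBound r k n f) q ν
    (fun y => if y = 1 then (-1) ^ μ' else 1) hf0 (fun x _ => hΨ x)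
    (fun x hx y hy => by
      have h1 := modulusBound_le_of_rho_le (k := k) hf (hE x y) (rho_pos hn x).le
        (rho_le_angDist_mul hn x y)
      have h2 := hE x y
      have h3 := hΨ y
      calc _ ≤ _ := h1
        _ = 2 ^ (r + k) * angDist n x y ^ (r + k) * modulusBound r k n f y := by rw [mul_pow]
        _ ≤ _ := by
          gcongr
          · exact le_max_right _ _
          · exact le_max_right _ _)
    hqd
    (fun x hx y hy => by
      have h2 := hE x y
      have h3 := hΨ y
      refine (hqe y hy x hx).trans ?_
      gcongr
      · exact le_max_left _ _
      · exact le_max_left _ _)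
    (fun y _ => by
      simp only [ν]
      split_ifs
      · exact le_max_right _ _
      · exact le_max_left _ _)
    (fun y hy x hx => by
      by_cases h1 : y = 1
      · subst h1
        simp only [ν, true_or, if_true]
        rw [abs_of_nonpos (by linarith [hx.2]), ← mul_pow]
        ring
      · rw [if_neg h1, one_mul]
        by_cases h2 : y = -1
        · subst h2
          rw [abs_of_nonneg (by linarith [hx.1])]
        · simp only [ν, h1, h2, or_self, if_false]
          rw [hμ.pow_abs])
    (fun y hy x hx hxy => by
      have h3 := hΨ y
      have h4 : 0 ≤ |x - y| / rho n y := div_nonneg (abs_nonneg _) (rho_pos hn y).le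
      have h5 : B₀ * modulusBound r k n f y * (|x - y| / rho n y) ^ ν y ≤
          B * modulusBound r k n f y * (|x - y| / rho n y) ^ ν y := by
        gcongr
        exact le_max_left _ _
      refine (neg_le_neg h5).trans ?_
      by_cases h1 : y = 1 ∨ y = -1
      · simp only [ν, if_pos h1]
        exact (hqend y (hSI y hy) h1).2 x hx hxy
      · simp only [ν, if_neg h1]
        exact (hqint y (hSI y hy) (hzone y hy h1)).2 x hx hxy)
  have hend : ∀ y, (y = 1 ∨ y = -1) → ∀ i < a', (derivative^[i] P).eval y =
      iteratedDerivWithin i f (Set.Icc (-1 : ℝ) 1) y := by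
    intro y hy i hi
    have hyS : y ∈ S := by rcases hy with rfl | rfl <;> simp [S]
    have h1 := hPi y hyS
    simp only [ν, if_pos hy] at h1
    rw [iterate_derivative_eval_eq h1 (by omega)]
    exact (hqend y (hSI y hyS) hy).1 i hi
  refine ⟨P, hPd.trans ((Nat.mul_le_mul_right n (le_max_left _ _)).trans hDn), hP0,
    fun i hi j => ?_, fun i hi => ⟨hend 1 (Or.inl rfl) i hi, hend (-1) (Or.inr rfl) i hi⟩,
    fun x hx => (hPe x hx).trans ?_⟩
  · by_cases h1 : α j = 1 ∨ α j = -1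
    · exact hend _ h1 i (by omega)
    · have hyS : α j ∈ S := hmem.2 (Or.inl ⟨j, rfl⟩)
      have h2 := hPi _ hyS
      simp only [ν, if_neg h1] at h2
      rw [iterate_derivative_eval_eq h2 (by omega)]
      exact (hqint _ (hSI _ hyS) (hzone _ hyS h1)).1 i hi
  · rw [mul_assoc]
    gcongr
    refine modulusBound_le_of_rho_le hf ?_ (rho_pos hn x).le
      (rho_le_of_le_mul hn hND hN1 (by omega) x)
    exact one_le_pow₀ (by exact_mod_cast (by omega : 1 ≤ 2 * D))

end Assembly

end PositiveApprox

/-- Positive polynomial approximation with interpolatory constraints, for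
`(r,k,m₁,m₃)` in the admissible index set
`{(0,2,0,0), (1,2,0,0), (1,3,0,0), (2,3,1,1)}`
`∪ {(2j,k,2j-1,2j-1) : j,k ≥ 1} ∪ {(2j+1,k,2j-1,2j) : j ≥ 0, k ≥ 1}`. -/
theorem statement4 (p : ℕ) (hp : 1 ≤ p)
    (r k : ℕ) (m₁ : ℤ) (m₃ : ℕ)
    (hm : (r = 0 ∧ k = 2 ∧ m₁ = 0 ∧ m₃ = 0)
        ∨ (r = 1 ∧ k = 2 ∧ m₁ = 0 ∧ m₃ = 0)
        ∨ (r = 1 ∧ k = 3 ∧ m₁ = 0 ∧ m₃ = 0)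
        ∨ (r = 2 ∧ k = 3 ∧ m₁ = 1 ∧ m₃ = 1)
        ∨ (∃ j : ℕ, 1 ≤ j ∧ 1 ≤ k ∧ r = 2 * j ∧ m₁ = 2 * (j : ℤ) - 1 ∧ m₃ = 2 * j - 1)
        ∨ (∃ j : ℕ, 1 ≤ k ∧ r = 2 * j + 1 ∧ m₁ = 2 * (j : ℤ) - 1 ∧ m₃ = 2 * j)) :
    ∃ c : ℝ, 0 < c ∧ ∃ Nf : ℝ → ℕ,
      ∀ (α : Fin p → ℝ), StrictAnti α → (∀ j, α j ∈ Set.Icc (-1 : ℝ) 1) →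
      ∀ f : ℝ → ℝ, ContDiffOn ℝ r f (Set.Icc (-1 : ℝ) 1) →
      (∀ x ∈ Set.Icc (-1 : ℝ) 1, 0 ≤ f x) →
      ∀ n : ℕ, Nf (minGap (Set.range α ∪ {-1, 1})) ≤ n →
      ∃ P : Polynomial ℝ, P.natDegree ≤ n ∧
        (∀ x ∈ Set.Icc (-1 : ℝ) 1, 0 ≤ P.eval x) ∧
        (∀ i : ℕ, (i : ℤ) ≤ m₁ → ∀ j : Fin p,
          (Polynomial.derivative^[i] P).eval (α j)
            = iteratedDerivWithin i f (Set.Icc (-1 : ℝ) 1) (α j)) ∧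
        (∀ i : ℕ, i ≤ m₃ →
          (Polynomial.derivative^[i] P).eval 1
            = iteratedDerivWithin i f (Set.Icc (-1 : ℝ) 1) 1 ∧
          (Polynomial.derivative^[i] P).eval (-1)
            = iteratedDerivWithin i f (Set.Icc (-1 : ℝ) 1) (-1)) ∧
        ∀ x ∈ Set.Icc (-1 : ℝ) 1,
          |f x - P.eval x| ≤ c * rho n x ^ r *
            omegaK (iteratedDerivWithin r f (Set.Icc (-1 : ℝ) 1)) k (rho n x) (-1) 1 := by
  suffices H : ∃ a μ a' μ' : ℕ, PositiveApprox.HasLocalModels r k a μ a' μ' ∧ Even μ ∧ a ≤ a' ∧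
      a ≤ μ ∧ a' ≤ μ' ∧ (a : ℤ) = m₁ + 1 ∧ a' = m₃ + 1 by
    obtain ⟨a, μ, a', μ', H, hμ, ha, haμ, ha', h1, h3⟩ := H
    obtain ⟨c, hc, Nf, h⟩ := PositiveApprox.exists_positive_interpolant p H hμ ha haμ ha'
    refine ⟨c, hc, Nf, fun α _ hα f hf hf0 n hn => ?_⟩
    obtain ⟨P, hd, h0, hi, he, hP⟩ := h α hα f hf hf0 n hn
    refine ⟨P, hd, h0, fun i him => hi i (by omega), fun i him => he i (by omega),
      fun x hx => (hP x hx).trans (le_of_eq ?_)⟩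
    rw [PositiveApprox.modulusBound, mul_assoc]
  rcases hm with ⟨rfl, rfl, rfl, rfl⟩ | ⟨rfl, rfl, rfl, rfl⟩ | ⟨rfl, rfl, rfl, rfl⟩ |
    ⟨rfl, rfl, rfl, rfl⟩ | ⟨j, hj, hk, rfl, rfl, rfl⟩ | ⟨j, hk, rfl, rfl, rfl⟩
  · exact ⟨_, _, _, _, PositiveApprox.hasLocalModels_zero, even_two, le_rfl, one_le_two, le_rfl,
      rfl, rfl⟩
  · exact ⟨_, _, _, _, PositiveApprox.hasLocalModels_one one_le_two (by norm_num), even_two,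
      le_rfl, one_le_two, le_rfl, rfl, rfl⟩
  · exact ⟨_, _, _, _, PositiveApprox.hasLocalModels_one (by norm_num) le_rfl, even_two,
      le_rfl, one_le_two, le_rfl, rfl, rfl⟩
  · exact ⟨_, 2, _, 2, PositiveApprox.hasLocalModels_of_le (by norm_num) le_rfl le_rfl, even_two,
      le_rfl, le_rfl, le_rfl, rfl, rfl⟩
  · exact ⟨_, _, _, _, PositiveApprox.hasLocalModels_of_le hk le_rfl le_rfl, even_two_mul j,
      le_rfl, le_rfl, le_rfl, by push_cast; ring, by omega⟩
  · exact ⟨_, _, _, _, PositiveApprox.hasLocalModels_of_le hk (Nat.le_succ (2 * j)) le_rfl,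
      even_two_mul j, Nat.le_succ _, le_rfl, le_rfl, by push_cast; ring, rfl⟩
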